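/- arXiv:1412.2464 — 3 statements merged into one kernel-verified Lean document; each statement's English description precedes it below -/
import Mathlib

section
/- Let ξ₁, ξ₂ > 0, s₀ = ξ₁+ξ₂, and let C₁, C₂ ∈ ℝ. Define A_n = (C₂e^{(2n+1)ξ₁} − C₁)/(e^{(2n+1)s₀} − 1) and B_n = (C₁e^{(2n+1)ξ₂} − C₂)/(e^{(2n+1)s₀} − 1). Then for every ξ ∈ [−ξ₁, ξ₂] and θ ∈ [0,π], all series below converge absolutely and √2·w_θ(ξ)·∑_{n=0}^∞ (A_n e^{(n+1/2)ξ} + B_n e^{−(n+1/2)ξ}) P_n(cos θ) = C₂·S(ξ,θ;2ξ₂) − C₁·S(ξ,θ;2s₀) + C₁·S(−ξ,θ;2ξ₁) − C₂·S(−ξ,θ;2s₀). -/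
open Real

noncomputable section

/-- `w θ ξ = √(cosh ξ − cos θ)`. -/
def w (θ ξ : ℝ) : ℝ := Real.sqrt (Real.cosh ξ - Real.cos θ)

/-- The `n`-th Legendre polynomial via the Rodrigues formula. -/
def legendreP (n : ℕ) (x : ℝ) : ℝ :=
  (1 / (2 ^ n * (n.factorial : ℝ))) * iteratedDeriv n (fun y : ℝ => (y ^ 2 - 1) ^ n) x

open Polynomial in
theorem iteratedDeriv_polynomial_eval (p : ℝ[X]) (k : ℕ) :
    iteratedDeriv k (fun y => p.eval y) = fun y => (derivative^[k] p).eval y := by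
  induction k with
  | zero => simp
  | succ k ih =>
    rw [iteratedDeriv_succ, ih, Function.iterate_succ_apply']
    ext y
    exact Polynomial.deriv _

open Polynomial in
theorem legendreP_eq_eval (n : ℕ) (x : ℝ) :
    legendreP n x =
      (derivative^[n] ((X ^ 2 - 1 : ℝ[X]) ^ n)).eval x / (2 ^ n * (n.factorial : ℝ)) := by
  have h := congrFun (iteratedDeriv_polynomial_eval ((X ^ 2 - 1 : ℝ[X]) ^ n) n) x
  simp only [eval_pow, eval_sub, eval_X, eval_one] at h
  rw [legendreP, h]
  ring

open Polynomial in
theorem iterate_derivative_succ_sq_sub_one_pow_succ (k n : ℕ) :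
    derivative^[k + 1] ((X ^ 2 - 1 : ℝ[X]) ^ (n + 1)) =
      2 * ((n : ℝ[X]) + 1) * (derivative^[k] ((X ^ 2 - 1 : ℝ[X]) ^ n) * X +
        (k : ℝ[X]) * derivative^[k - 1] ((X ^ 2 - 1 : ℝ[X]) ^ n)) := by
  have h : derivative ((X ^ 2 - 1 : ℝ[X]) ^ (n + 1)) =
      ((2 * (n + 1) : ℕ) : ℝ[X]) * ((X ^ 2 - 1) ^ n * X) := by
    rw [derivative_pow_succ]
    simp
    ring
  rw [Function.iterate_succ_apply, h, iterate_derivative_natCast_mul,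
    iterate_derivative_mul_X, nsmul_eq_mul]
  push_cast
  ring

open Polynomial in
theorem iterate_derivative_sq_sub_one_pow_succ (n : ℕ) :
    ((n : ℝ[X]) + 2) * derivative^[n] ((X ^ 2 - 1 : ℝ[X]) ^ (n + 1)) =
      2 * ((n : ℝ[X]) + 1) * ((X ^ 2 - 1) * derivative^[n] ((X ^ 2 - 1 : ℝ[X]) ^ n) +
        (n : ℝ[X]) * (X * derivative^[n - 1] ((X ^ 2 - 1 : ℝ[X]) ^ n))) := by
  obtain _ | k := n
  · simp
  have h₁ := iterate_derivative_succ_sq_sub_one_pow_succ k (k + 1)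
  have h₂ : derivative^[k + 1] ((X ^ 2 - 1 : ℝ[X]) ^ (k + 1 + 1)) =
      (X ^ 2 - 1) * derivative^[k + 1] ((X ^ 2 - 1 : ℝ[X]) ^ (k + 1)) +
      2 * ((k : ℝ[X]) + 1) * (X * derivative^[k] ((X ^ 2 - 1 : ℝ[X]) ^ (k + 1))) +
      ((k : ℝ[X]) + 1) * (k : ℝ[X]) * derivative^[k - 1] ((X ^ 2 - 1 : ℝ[X]) ^ (k + 1)) := by
    rw [show (X ^ 2 - 1 : ℝ[X]) ^ (k + 1 + 1) =
      (X ^ 2 - 1) ^ (k + 1) * X * X - (X ^ 2 - 1) ^ (k + 1) by ring]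
    simp only [iterate_derivative_sub, iterate_derivative_mul_X, nsmul_eq_mul,
      Nat.add_sub_cancel]
    push_cast
    ring
  simp only [Nat.add_sub_cancel] at h₁ ⊢
  push_cast at h₁ ⊢
  linear_combination 2 * ((k : ℝ[X]) + 2) * h₂ - ((k : ℝ[X]) + 1) * h₁

theorem legendreP_zero (x : ℝ) : legendreP 0 x = 1 := by
  simp [legendreP]

theorem legendreP_one (x : ℝ) : legendreP 1 x = x := by
  simp [legendreP_eq_eval]
  ring

open Polynomial in
/-- Bonnet's recursion. -/
theorem legendreP_add_two (n : ℕ) (x : ℝ) :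
    ((n : ℝ) + 2) * legendreP (n + 2) x =
      (2 * n + 3) * x * legendreP (n + 1) x - (n + 1) * legendreP n x := by
  have h₁ := congrArg (eval x) (iterate_derivative_succ_sq_sub_one_pow_succ n n)
  have h₂ := congrArg (eval x) (iterate_derivative_succ_sq_sub_one_pow_succ (n + 1) (n + 1))
  have h₃ := congrArg (eval x) (iterate_derivative_sq_sub_one_pow_succ n)
  simp only [legendreP_eq_eval, Nat.factorial_succ]
  simp only [Nat.cast_add, Nat.cast_one, eval_mul, eval_add, eval_sub, eval_pow, eval_X,
    eval_natCast, eval_one, eval_ofNat, Nat.add_sub_cancel] at h₁ h₂ h₃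
  push_cast
  rw [show n + 2 = n + 1 + 1 from rfl]
  have hn : (n.factorial : ℝ) ≠ 0 := by positivity
  have hn1 : (n : ℝ) + 1 ≠ 0 := by positivity
  have hn2 : (n : ℝ) + 1 + 1 ≠ 0 := by positivity
  field_simp
  generalize eval x (derivative^[n] ((X ^ 2 - 1 : ℝ[X]) ^ n)) = p₀ at *
  generalize eval x (derivative^[n + 1] ((X ^ 2 - 1 : ℝ[X]) ^ (n + 1))) = p₁ at *
  generalize eval x (derivative^[n + 1 + 1] ((X ^ 2 - 1 : ℝ[X]) ^ (n + 1 + 1))) = p₂ at *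
  generalize eval x (derivative^[n] ((X ^ 2 - 1 : ℝ[X]) ^ (n + 1))) = i₁ at *
  generalize eval x (derivative^[n - 1] ((X ^ 2 - 1 : ℝ[X]) ^ n)) = i₀ at *
  rw [pow_succ, pow_succ]
  linear_combination 2 * ((2 : ℝ) ^ n) ^ 2 * (n + 2) * h₂ +
    4 * ((2 : ℝ) ^ n) ^ 2 * (n + 2) * (n + 1) * (h₃ - x * h₁)

/-- The power series of `1 / √(1 - X)`. -/
def invSqrtSeries : PowerSeries ℂ :=
  PowerSeries.mk fun n => (n.centralBinom : ℂ) / 4 ^ n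

open PowerSeries in
theorem invSqrtSeries_sq_mul : invSqrtSeries ^ 2 * (1 - X) = 1 := by
  have h : 2 * (d⁄dX ℂ invSqrtSeries * (1 - X)) = invSqrtSeries := by
    ext n
    rw [show (2 : PowerSeries ℂ) = C (2 : ℂ) from (map_ofNat C 2).symm, coeff_C_mul, mul_sub,
      mul_one, map_sub, coeff_derivative]
    have key : ∀ n : ℕ, ((n : ℂ) + 1) * (n + 1).centralBinom
        = 2 * (2 * n + 1) * n.centralBinom := fun n => by
      exact_mod_cast Nat.succ_mul_centralBinom_succ n
    obtain _ | n := n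
    · simp [invSqrtSeries, Nat.centralBinom, Nat.choose]
      norm_num
    · rw [coeff_succ_mul_X, coeff_derivative]
      simp only [invSqrtSeries, coeff_mk]
      have := key (n + 1)
      push_cast at this ⊢
      simp only [pow_succ]
      field_simp
      linear_combination 2 * this
  refine derivative.ext ?_ (by simp [invSqrtSeries])
  simp only [Derivation.leibniz, Derivation.leibniz_pow, map_sub, smul_eq_mul, derivative_X,
    Derivation.map_one_eq_zero, nsmul_eq_mul]
  push_cast
  linear_combination invSqrtSeries * h

open PowerSeries in
theorem coeff_rescale_invSqrtSeries_mul_eq_legendreP (x : ℝ) (α β : ℂ) (hadd : α + β = 2 * x)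
    (hmul : α * β = 1) (n : ℕ) :
    coeff n (rescale α invSqrtSeries * rescale β invSqrtSeries) = legendreP n x := by
  set F := rescale α invSqrtSeries * rescale β invSqrtSeries with hF
  set D : PowerSeries ℂ := 1 - C (2 * x : ℂ) * X + X ^ 2 with hD
  have hFD : F ^ 2 * D = 1 := by
    have ha := congrArg (rescale α) invSqrtSeries_sq_mul
    have hb := congrArg (rescale β) invSqrtSeries_sq_mul
    simp only [map_mul, map_pow, map_sub, map_one, rescale_X] at ha hb
    have hD' : D = (1 - C α * X) * (1 - C β * X) := by
      have h1 : C α + C β = C (2 * x : ℂ) := by rw [← map_add, hadd]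
      have h2 : C α * C β = (1 : PowerSeries ℂ) := by rw [← map_mul, hmul, map_one]
      rw [hD]
      linear_combination X * h1 - X ^ 2 * h2
    rw [hD', hF]
    linear_combination ha * (rescale β invSqrtSeries ^ 2 * (1 - C β * X)) + hb
  have hF0 : F ≠ 0 := by
    rintro h
    simp [h] at hFD
  have hode : d⁄dX ℂ F * D = F * (C (x : ℂ) - X) := by
    have h := congrArg (d⁄dX ℂ) hFD
    simp only [hD, Derivation.leibniz, Derivation.leibniz_pow, map_sub, map_add, smul_eq_mul,
      derivative_X, Derivation.map_one_eq_zero, nsmul_eq_mul, derivative_C] at h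
    push_cast at h
    have h2 : C (2 * x : ℂ) = 2 * C (x : ℂ) := by
      rw [map_mul, map_ofNat]
    have h20 : (2 : PowerSeries ℂ) ≠ 0 := by
      rw [← map_ofNat (C (R := ℂ)) 2, map_ne_zero_iff _ C_injective]
      norm_num
    refine mul_left_cancel₀ (mul_ne_zero h20 hF0) ?_
    rw [hD]
    rw [h2] at h ⊢
    linear_combination h
  have h0 : coeff 0 F = 1 := by
    rw [hF, coeff_mul]
    simp [invSqrtSeries]
  have h1 : coeff 1 F = x := by
    have := congrArg (coeff 0) hode
    simp only [hD, map_mul, map_add, map_sub, coeff_zero_eq_constantCoeff, map_one, constantCoeff_X,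
      constantCoeff_C, map_pow] at this
    rw [← coeff_zero_eq_constantCoeff_apply, ← coeff_zero_eq_constantCoeff_apply,
      coeff_derivative, h0] at this
    simpa using this
  have hrec : ∀ n : ℕ, ((n : ℂ) + 2) * coeff (n + 2) F =
      (2 * n + 3) * x * coeff (n + 1) F - (n + 1) * coeff n F := fun n => by
    have h := congrArg (coeff (n + 1)) hode
    rw [show d⁄dX ℂ F * D = d⁄dX ℂ F - C (2 * x : ℂ) * (d⁄dX ℂ F * X) + d⁄dX ℂ F * X * X by
      rw [hD]; ring,
      show F * (C (x : ℂ) - X) = C (x : ℂ) * F - F * X by ring] at h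
    simp only [map_add, map_sub, coeff_C_mul, coeff_succ_mul_X, coeff_derivative] at h
    obtain _ | n := n
    · simp at h ⊢
      linear_combination h
    · simp only [coeff_succ_mul_X, coeff_derivative] at h
      push_cast at h ⊢
      linear_combination h
  induction n using Nat.twoStepInduction with
  | zero => simp [h0, legendreP_zero]
  | one => rw [h1, legendreP_one]
  | more n ih₀ ih₁ =>
    have hn : (n : ℂ) + 2 ≠ 0 := by exact_mod_cast (by omega : n + 2 ≠ 0)
    refine mul_left_cancel₀ hn ?_
    rw [hrec, ih₀, ih₁]
    exact_mod_cast (legendreP_add_two n x).symm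

theorem norm_coeff_invSqrtSeries_le_one (n : ℕ) : ‖PowerSeries.coeff n invSqrtSeries‖ ≤ 1 := by
  have h : n.centralBinom ≤ 4 ^ n := by
    calc n.centralBinom ≤ 2 ^ (2 * n) := Nat.choose_le_two_pow _ _
      _ = 4 ^ n := by rw [pow_mul]; norm_num
  simp only [invSqrtSeries, PowerSeries.coeff_mk, norm_div, Complex.norm_natCast, norm_pow,
    Complex.norm_ofNat]
  rw [div_le_one (by positivity)]
  exact_mod_cast h

theorem summable_norm_invSqrtSeries {z : ℂ} (hz : ‖z‖ < 1) :
    Summable fun n => ‖PowerSeries.coeff n invSqrtSeries * z ^ n‖ := by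
  refine Summable.of_nonneg_of_le (fun _ => norm_nonneg _) (fun n => ?_)
    (summable_geometric_of_lt_one (norm_nonneg z) hz)
  rw [norm_mul, norm_pow]
  exact mul_le_of_le_one_left (by positivity) (norm_coeff_invSqrtSeries_le_one n)

open PowerSeries in
theorem tsum_invSqrtSeries_sq {z : ℂ} (hz : ‖z‖ < 1) :
    (∑' n, coeff n invSqrtSeries * z ^ n) ^ 2 * (1 - z) = 1 := by
  have hs := summable_norm_invSqrtSeries hz
  have hsq : invSqrtSeries ^ 2 = PowerSeries.mk 1 := by
    have h := mk_one_mul_one_sub_eq_one ℂ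
    linear_combination PowerSeries.mk 1 * invSqrtSeries_sq_mul - invSqrtSeries ^ 2 * h
  have hz1 : 1 - z ≠ 0 := by
    rintro h
    rw [← sub_eq_zero.mp h] at hz
    simp at hz
  rw [sq, tsum_mul_tsum_eq_tsum_sum_antidiagonal_of_summable_norm hs hs]
  have : ∀ n, ∑ kl ∈ Finset.HasAntidiagonal.antidiagonal n, coeff kl.1 invSqrtSeries * z ^ kl.1 *
      (coeff kl.2 invSqrtSeries * z ^ kl.2) = z ^ n := fun n => by
    have h := congrArg (coeff n) hsq
    rw [sq, coeff_mul, coeff_mk, Pi.one_apply] at h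
    rw [← one_mul (z ^ n), ← h, Finset.sum_mul]
    refine Finset.sum_congr rfl fun kl hkl => ?_
    rw [← Finset.HasAntidiagonal.mem_antidiagonal.mp hkl, pow_add]
    ring
  simp_rw [this]
  rw [tsum_geometric_of_norm_lt_one hz, inv_mul_cancel₀ hz1]

open PowerSeries in
theorem legendreP_mul_pow_eq_sum_antidiagonal (θ t : ℝ) (n : ℕ) :
    ((legendreP n (Real.cos θ) * t ^ n : ℝ) : ℂ) =
      ∑ kl ∈ Finset.HasAntidiagonal.antidiagonal n,
        coeff kl.1 invSqrtSeries * (Complex.exp (θ * Complex.I) * t) ^ kl.1 *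
        (coeff kl.2 invSqrtSeries * (Complex.exp (-θ * Complex.I) * t) ^ kl.2) := by
  have h := coeff_rescale_invSqrtSeries_mul_eq_legendreP (Real.cos θ)
    (Complex.exp (θ * Complex.I)) (Complex.exp (-θ * Complex.I))
    (by rw [Complex.ofReal_cos, Complex.cos]; ring) (by rw [← Complex.exp_add]; simp) n
  push_cast at h ⊢
  rw [← h, coeff_mul, Finset.sum_mul]
  refine Finset.sum_congr rfl fun kl hkl => ?_
  rw [← Finset.HasAntidiagonal.mem_antidiagonal.mp hkl, pow_add, coeff_rescale, coeff_rescale]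
  ring

theorem norm_exp_mul_I_mul_lt_one (θ : ℝ) {t : ℝ} (ht : |t| < 1) :
    ‖Complex.exp (θ * Complex.I) * t‖ < 1 := by
  rwa [norm_mul, Complex.norm_exp_ofReal_mul_I, one_mul, Complex.norm_real]

theorem norm_exp_neg_mul_I_mul_lt_one (θ : ℝ) {t : ℝ} (ht : |t| < 1) :
    ‖Complex.exp (-θ * Complex.I) * t‖ < 1 := by
  exact_mod_cast norm_exp_mul_I_mul_lt_one (-θ) ht

theorem summable_abs_legendreP_mul_pow (θ : ℝ) {t : ℝ} (ht : |t| < 1) :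
    Summable fun n => |legendreP n (Real.cos θ) * t ^ n| := by
  have h := summable_norm_sum_mul_antidiagonal_of_summable_norm
    (summable_norm_invSqrtSeries (norm_exp_mul_I_mul_lt_one θ ht))
    (summable_norm_invSqrtSeries (norm_exp_neg_mul_I_mul_lt_one θ ht))
  simp_rw [← legendreP_mul_pow_eq_sum_antidiagonal, Complex.norm_real] at h
  exact h

open PowerSeries ComplexConjugate in
/-- The generating function of the Legendre polynomials. -/
theorem hasSum_legendreP_mul_pow (θ : ℝ) {t : ℝ} (ht : |t| < 1) :
    HasSum (fun n => legendreP n (Real.cos θ) * t ^ n)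
      (1 / Real.sqrt (1 - 2 * t * Real.cos θ + t ^ 2)) := by
  have hα := norm_exp_mul_I_mul_lt_one θ ht
  have hβ := norm_exp_neg_mul_I_mul_lt_one θ ht
  have hsum := (summable_abs_legendreP_mul_pow θ ht).of_abs
  have hv := tsum_invSqrtSeries_sq hα
  have hprod := tsum_mul_tsum_eq_tsum_sum_antidiagonal_of_summable_norm
    (summable_norm_invSqrtSeries hα) (summable_norm_invSqrtSeries hβ)
  simp_rw [← legendreP_mul_pow_eq_sum_antidiagonal] at hprod
  rw [← Complex.ofReal_tsum] at hprod
  have hconj : ∑' n, coeff n invSqrtSeries * (Complex.exp (-θ * Complex.I) * t) ^ n =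
      conj (∑' n, coeff n invSqrtSeries * (Complex.exp (θ * Complex.I) * t) ^ n) := by
    rw [Complex.conj_tsum]
    refine tsum_congr fun n => ?_
    simp [invSqrtSeries, ← Complex.exp_conj, map_ofNat (starRingEnd ℂ) 4]
  rw [hconj, Complex.mul_conj] at hprod
  set v := ∑' n, coeff n invSqrtSeries * (Complex.exp (θ * Complex.I) * t) ^ n
  have hL : ∑' n, legendreP n (Real.cos θ) * t ^ n = Complex.normSq v := by
    exact_mod_cast hprod.symm
  have hq : Complex.normSq (1 - Complex.exp (θ * Complex.I) * t) =
      1 - 2 * t * Real.cos θ + t ^ 2 := by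
    rw [Complex.exp_mul_I, ← Complex.ofReal_cos, ← Complex.ofReal_sin, Complex.normSq_apply]
    simp [-Complex.ofReal_cos, -Complex.ofReal_sin]
    linear_combination t ^ 2 * Real.sin_sq_add_cos_sq θ
  have hN := congrArg Complex.normSq hv
  rw [map_mul, map_pow, hq, map_one] at hN
  have hL' : Complex.normSq v = 1 / Real.sqrt (1 - 2 * t * Real.cos θ + t ^ 2) := by
    rw [one_div, ← Real.sqrt_inv, inv_eq_one_div,
      ← eq_div_of_mul_eq (right_ne_zero_of_mul_eq_one hN) hN,
      Real.sqrt_sq (Complex.normSq_nonneg v)]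
  rw [← hL', ← hL]
  exact hsum.hasSum

theorem w_neg (θ u : ℝ) : w θ (-u) = w θ u := by
  rw [w, w, Real.cosh_neg]

theorem abs_exp_neg_lt_one {u : ℝ} (hu : 0 < u) : |Real.exp (-u)| < 1 := by
  rw [Real.abs_exp]
  exact Real.exp_lt_one_iff.mpr (neg_lt_zero.mpr hu)

theorem exp_neg_add_half_mul (n : ℕ) (u : ℝ) :
    Real.exp (-(n + 1 / 2) * u) = Real.exp (-(u / 2)) * Real.exp (-u) ^ n := by
  rw [← Real.exp_nat_mul, ← Real.exp_add]
  ring_nf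

theorem summable_abs_legendreP_mul_exp (θ : ℝ) {u : ℝ} (hu : 0 < u) :
    Summable fun n : ℕ => |legendreP n (Real.cos θ) * Real.exp (-(n + 1 / 2) * u)| := by
  refine ((summable_abs_legendreP_mul_pow θ (abs_exp_neg_lt_one hu)).mul_left
    (Real.exp (-(u / 2)))).congr fun n => ?_
  rw [exp_neg_add_half_mul, ← mul_assoc, mul_right_comm, abs_mul _ (Real.exp (-(u / 2))),
    Real.abs_exp, mul_comm]

theorem tsum_legendreP_mul_exp (θ : ℝ) {u : ℝ} (hu : 0 < u) :
    ∑' n : ℕ, legendreP n (Real.cos θ) * Real.exp (-(n + 1 / 2) * u) =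
      1 / (Real.sqrt 2 * w θ u) := by
  have h := ((hasSum_legendreP_mul_pow θ (abs_exp_neg_lt_one hu)).mul_left
    (Real.exp (-(u / 2)))).tsum_eq
  have hw : 1 - 2 * Real.exp (-u) * Real.cos θ + Real.exp (-u) ^ 2 =
      Real.exp (-(u / 2)) ^ 2 * (2 * (Real.cosh u - Real.cos θ)) := by
    have h1 : Real.exp (-(u / 2)) ^ 2 = Real.exp (-u) := by
      rw [← Real.exp_nat_mul]; congr 1; push_cast; ring
    have h2 : Real.exp (-u) * Real.exp u = 1 := by rw [← Real.exp_add]; simp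
    rw [h1, Real.cosh_eq]
    linear_combination -h2
  rw [hw, Real.sqrt_mul (sq_nonneg _), Real.sqrt_sq (Real.exp_pos _).le,
    Real.sqrt_mul zero_le_two, mul_one_div, ← div_div, div_self (Real.exp_pos _).ne'] at h
  rw [w, ← h]
  refine tsum_congr fun n => ?_
  rw [exp_neg_add_half_mul]
  ring

/-- Summing the generating function along an arithmetic progression of arguments. -/
theorem summable_and_hasSum_legendreP_mul_exp_div (θ : ℝ) {c s : ℝ} (hc : 0 < c) (hs : 0 < s) :
    (Summable fun m : ℕ => 1 / (Real.sqrt 2 * w θ (2 * m * s + c))) ∧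
    (Summable fun n : ℕ => |legendreP n (Real.cos θ) *
      (Real.exp (-(n + 1 / 2) * c) / (1 - Real.exp (-((2 * n + 1) * s))))|) ∧
    HasSum (fun n : ℕ => legendreP n (Real.cos θ) *
      (Real.exp (-(n + 1 / 2) * c) / (1 - Real.exp (-((2 * n + 1) * s)))))
      (∑' m : ℕ, 1 / (Real.sqrt 2 * w θ (2 * m * s + c))) := by
  set f : ℕ × ℕ → ℝ := fun p =>
    legendreP p.1 (Real.cos θ) * Real.exp (-(p.1 + 1 / 2) * (2 * p.2 * s + c)) with hf
  have hfac : ∀ n m : ℕ, f (n, m) = legendreP n (Real.cos θ) * Real.exp (-(n + 1 / 2) * c) *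
      Real.exp (-((2 * n + 1) * s)) ^ m := fun n m => by
    rw [hf, mul_assoc, ← Real.exp_nat_mul, ← Real.exp_add]
    ring_nf
  have hgeo : ∀ n : ℕ, HasSum (fun m : ℕ => Real.exp (-((2 * n + 1) * s)) ^ m)
      (1 - Real.exp (-((2 * n + 1) * s)))⁻¹ := fun n =>
    hasSum_geometric_of_lt_one (Real.exp_pos _).le
      (Real.exp_lt_one_iff.mpr (neg_lt_zero.mpr (by positivity)))
  have hsum : Summable fun p => |f p| := by
    have hprod := (summable_abs_legendreP_mul_exp θ hc).mul_of_nonneg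
      (hgeo 0).summable (fun _ => abs_nonneg _) (fun _ => by positivity)
    refine Summable.of_nonneg_of_le (fun _ => abs_nonneg _) (fun p => ?_) hprod
    obtain ⟨n, m⟩ := p
    rw [hfac, abs_mul, abs_of_nonneg (a := _ ^ m) (by positivity)]
    gcongr
    simp
  have hfib : ∀ n : ℕ, HasSum (fun m => f (n, m)) (legendreP n (Real.cos θ) *
      (Real.exp (-(n + 1 / 2) * c) / (1 - Real.exp (-((2 * n + 1) * s))))) := fun n => by
    simp_rw [hfac, div_eq_mul_inv, ← mul_assoc]
    exact (hgeo n).mul_left _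
  have hfib' : ∀ m : ℕ, HasSum (fun n => f (n, m)) (1 / (Real.sqrt 2 * w θ (2 * m * s + c))) :=
    fun m => by
      have hu : 0 < 2 * m * s + c := by positivity
      rw [← tsum_legendreP_mul_exp θ hu]
      exact (summable_abs_legendreP_mul_exp θ hu).of_abs.hasSum
  have hswap : HasSum (fun p : ℕ × ℕ => f (p.2, p.1)) (∑' p, f p) :=
    (Equiv.prodComm ℕ ℕ).hasSum_iff.mpr hsum.of_abs.hasSum
  have hm := hswap.prod_fiberwise hfib'
  refine ⟨hm.summable, ?_, ?_⟩
  · refine Summable.of_nonneg_of_le (fun _ => abs_nonneg _) (fun n => ?_) hsum.prod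
    rw [← (hfib n).tsum_eq, ← Real.norm_eq_abs]
    exact norm_tsum_le_tsum_norm (hsum.prod_factor n)
  · rw [hm.tsum_eq]
    exact hsum.of_abs.hasSum.prod_fiberwise hfib

theorem div_w_eq (θ ξ y : ℝ) {z : ℝ} (hz : z = -y) :
    w θ ξ / w θ y = Real.sqrt 2 * w θ ξ * (1 / (Real.sqrt 2 * w θ z)) := by
  have h2 : Real.sqrt 2 ≠ 0 := by positivity
  rw [hz, w_neg, mul_one_div, mul_div_mul_left _ _ h2]

theorem exp_neg_div_one_sub_exp_neg (x y : ℝ) :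
    Real.exp (-x) / (1 - Real.exp (-y)) = Real.exp (y - x) / (Real.exp y - 1) := by
  have h : 1 - Real.exp (-y) = (Real.exp y - 1) / Real.exp y := by
    rw [Real.exp_neg, sub_div, div_self (Real.exp_pos y).ne', one_div]
  rw [h, sub_eq_neg_add y x, Real.exp_add, div_div_eq_mul_div]

theorem stmt3 (ξ₁ ξ₂ s₀ : ℝ) (hξ₁ : 0 < ξ₁) (hξ₂ : 0 < ξ₂) (hs₀ : s₀ = ξ₁ + ξ₂)
    (C₁ C₂ : ℝ) (A B : ℕ → ℝ)
    (hA : ∀ n : ℕ, A n = (C₂ * Real.exp ((2*n+1) * ξ₁) - C₁) / (Real.exp ((2*n+1) * s₀) - 1))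
    (hB : ∀ n : ℕ, B n = (C₁ * Real.exp ((2*n+1) * ξ₂) - C₂) / (Real.exp ((2*n+1) * s₀) - 1))
    (S : ℝ → ℝ → ℝ → ℝ)
    (hS : ∀ ξ θ s, S ξ θ s = ∑' m : ℕ, w θ ξ / w θ (ξ - 2 * m * s₀ - s)) :
    ∀ ξ ∈ Set.Icc (-ξ₁) ξ₂, ∀ θ ∈ Set.Icc 0 Real.pi,
      (Summable fun n : ℕ =>
        |(A n * Real.exp ((n + 1/2) * ξ) + B n * Real.exp (-(n + 1/2) * ξ)) *
          legendreP n (Real.cos θ)|) ∧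
      (Summable fun m : ℕ => |w θ ξ / w θ (ξ - 2 * m * s₀ - 2 * ξ₂)|) ∧
      (Summable fun m : ℕ => |w θ ξ / w θ (ξ - 2 * m * s₀ - 2 * s₀)|) ∧
      (Summable fun m : ℕ => |w θ (-ξ) / w θ (-ξ - 2 * m * s₀ - 2 * ξ₁)|) ∧
      (Summable fun m : ℕ => |w θ (-ξ) / w θ (-ξ - 2 * m * s₀ - 2 * s₀)|) ∧
      Real.sqrt 2 * w θ ξ *
          (∑' n : ℕ, (A n * Real.exp ((n + 1/2) * ξ) + B n * Real.exp (-(n + 1/2) * ξ)) *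
            legendreP n (Real.cos θ)) =
        C₂ * S ξ θ (2 * ξ₂) - C₁ * S ξ θ (2 * s₀) + C₁ * S (-ξ) θ (2 * ξ₁) -
          C₂ * S (-ξ) θ (2 * s₀) := by
  intro ξ hξ θ _
  obtain ⟨hξl, hξr⟩ := hξ
  have hs : 0 < s₀ := by linarith
  obtain ⟨ha, ha', hA'⟩ := summable_and_hasSum_legendreP_mul_exp_div θ
    (show 0 < 2 * ξ₂ - ξ by linarith) hs
  obtain ⟨hb, hb', hB'⟩ := summable_and_hasSum_legendreP_mul_exp_div θ
    (show 0 < 2 * s₀ - ξ by linarith) hs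
  obtain ⟨hc, hc', hC'⟩ := summable_and_hasSum_legendreP_mul_exp_div θ
    (show 0 < 2 * ξ₁ + ξ by linarith) hs
  obtain ⟨hd, hd', hD'⟩ := summable_and_hasSum_legendreP_mul_exp_div θ
    (show 0 < 2 * s₀ + ξ by linarith) hs
  have hterm : ∀ n : ℕ,
      (A n * Real.exp ((n + 1/2) * ξ) + B n * Real.exp (-(n + 1/2) * ξ)) *
        legendreP n (Real.cos θ) =
      C₂ * (legendreP n (Real.cos θ) *
        (Real.exp (-(n + 1 / 2) * (2 * ξ₂ - ξ)) / (1 - Real.exp (-((2 * n + 1) * s₀))))) -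
      C₁ * (legendreP n (Real.cos θ) *
        (Real.exp (-(n + 1 / 2) * (2 * s₀ - ξ)) / (1 - Real.exp (-((2 * n + 1) * s₀))))) +
      C₁ * (legendreP n (Real.cos θ) *
        (Real.exp (-(n + 1 / 2) * (2 * ξ₁ + ξ)) / (1 - Real.exp (-((2 * n + 1) * s₀))))) -
      C₂ * (legendreP n (Real.cos θ) *
        (Real.exp (-(n + 1 / 2) * (2 * s₀ + ξ)) / (1 - Real.exp (-((2 * n + 1) * s₀))))) := by
    intro n
    simp only [neg_mul (_ + _), exp_neg_div_one_sub_exp_neg]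
    rw [hA, hB,
      show (2 * n + 1) * s₀ - (n + 1 / 2) * (2 * ξ₂ - ξ) = (2 * n + 1) * ξ₁ + (n + 1 / 2) * ξ by
        rw [hs₀]; ring,
      show (2 * n + 1) * s₀ - (n + 1 / 2) * (2 * s₀ - ξ) = (n + 1 / 2) * ξ by ring,
      show (2 * n + 1) * s₀ - (n + 1 / 2) * (2 * ξ₁ + ξ) =
        (2 * n + 1) * ξ₂ + -((n + 1 / 2) * ξ) by rw [hs₀]; ring,
      show (2 * n + 1) * s₀ - (n + 1 / 2) * (2 * s₀ + ξ) = -((n + 1 / 2) * ξ) by ring,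
      Real.exp_add, Real.exp_add]
    ring
  have eA : ∀ m : ℕ, w θ ξ / w θ (ξ - 2 * m * s₀ - 2 * ξ₂) =
      Real.sqrt 2 * w θ ξ * (1 / (Real.sqrt 2 * w θ (2 * m * s₀ + (2 * ξ₂ - ξ)))) :=
    fun m => div_w_eq _ _ _ (by ring)
  have eB : ∀ m : ℕ, w θ ξ / w θ (ξ - 2 * m * s₀ - 2 * s₀) =
      Real.sqrt 2 * w θ ξ * (1 / (Real.sqrt 2 * w θ (2 * m * s₀ + (2 * s₀ - ξ)))) :=
    fun m => div_w_eq _ _ _ (by ring)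
  have eC : ∀ m : ℕ, w θ (-ξ) / w θ (-ξ - 2 * m * s₀ - 2 * ξ₁) =
      Real.sqrt 2 * w θ ξ * (1 / (Real.sqrt 2 * w θ (2 * m * s₀ + (2 * ξ₁ + ξ)))) :=
    fun m => by rw [w_neg]; exact div_w_eq _ _ _ (by ring)
  have eD : ∀ m : ℕ, w θ (-ξ) / w θ (-ξ - 2 * m * s₀ - 2 * s₀) =
      Real.sqrt 2 * w θ ξ * (1 / (Real.sqrt 2 * w θ (2 * m * s₀ + (2 * s₀ + ξ)))) :=
    fun m => by rw [w_neg]; exact div_w_eq _ _ _ (by ring)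
  simp only [hS, hterm, eA, eB, eC, eD]
  refine ⟨?_, (ha.mul_left _).abs, (hb.mul_left _).abs, (hc.mul_left _).abs,
    (hd.mul_left _).abs, ?_⟩
  · exact ((((ha'.of_abs.mul_left C₂).sub (hb'.of_abs.mul_left C₁)).add
      (hc'.of_abs.mul_left C₁)).sub (hd'.of_abs.mul_left C₂)).abs
  · rw [((((hA'.mul_left C₂).sub (hB'.mul_left C₁)).add (hC'.mul_left C₁)).sub
      (hD'.mul_left C₂)).tsum_eq]
    simp only [tsum_mul_left]
    ring

end
end

section
/- There exist C > 0 and ε₀ > 0 such that for all ε ∈ (0, ε₀): |U(ξ_j) − (1/(2s₀))[ln(2/s₀) − ψ₀(1 − ξ_j/s₀)]| ≤ C√ε for j = 1,2, and |U(0) − (1/(2s₀))[ln(2/s₀) + γ]| ≤ C√ε. -/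
open Real

noncomputable section

/-- The distance parameter `a_ε`. -/
def aEps (r₁ r₂ ε : ℝ) : ℝ :=
  Real.sqrt ε * Real.sqrt ((2*r₁+ε)*(2*r₂+ε)*(2*r₁+2*r₂+ε)) / (2*(r₁+r₂+ε))

def xi (r : ℝ) (r₁ r₂ ε : ℝ) : ℝ := Real.arsinh (aEps r₁ r₂ ε / r)

/-- `U(c) = ∑_{n≥0} e^{(2n+1)c}/(e^{(2n+1)s₀} − 1)`. -/
def U (s₀ c : ℝ) : ℝ := ∑' n : ℕ, Real.exp ((2*n+1) * c) / (Real.exp ((2*n+1) * s₀) - 1)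

/-- The digamma value `ψ₀(z) = −γ + ∑_{k≥0} (z−1)/((k+1)(k+z))`. -/
def digammaVal (z : ℝ) : ℝ :=
  -Real.eulerMascheroniConstant + ∑' k : ℕ, (z - 1) / ((k + 1) * (k + z))

/-- The regular part `1 / sinh x - 1 / x` of the hyperbolic cosecant. -/
def cschReg (x : ℝ) : ℝ := 1 / sinh x - 1 / x

/-- The first derivative of `cschReg`. -/
def cschRegDeriv (x : ℝ) : ℝ := 1 / x ^ 2 - cosh x / sinh x ^ 2

/-- The second derivative of `cschReg`. -/
def cschRegDeriv₂ (x : ℝ) : ℝ := (2 + sinh x ^ 2) / sinh x ^ 3 - 2 / x ^ 3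

/-- A primitive of the hyperbolic cosecant, namely `log (tanh (x / 2))`. -/
def cschPrim (x : ℝ) : ℝ := log (exp x - 1) - log (exp x + 1)

/-- A primitive of `cschReg`. -/
def cschRegPrim (x : ℝ) : ℝ := cschPrim x - log x

lemma hasDerivAt_cschPrim {x : ℝ} (hx : 0 < x) : HasDerivAt cschPrim (1 / sinh x) x := by
  have h1 : 1 < exp x := one_lt_exp_iff.2 hx
  have h := (((hasDerivAt_exp x).sub_const 1).log (by linarith)).sub
    (((hasDerivAt_exp x).add_const 1).log (by linarith))
  refine h.congr_deriv ?_
  have h2 : exp x - 1 ≠ 0 := by linarith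
  have h3 : exp x + 1 ≠ 0 := by linarith
  have h4 : exp x ^ 2 - 1 ≠ 0 := by nlinarith
  rw [sinh_eq, exp_neg]
  field_simp
  ring

lemma hasDerivAt_cschRegPrim {x : ℝ} (hx : 0 < x) : HasDerivAt cschRegPrim (cschReg x) x := by
  refine ((hasDerivAt_cschPrim hx).sub (hasDerivAt_log hx.ne')).congr_deriv ?_
  simp [cschReg]

lemma hasDerivAt_cschReg {x : ℝ} (hx : 0 < x) : HasDerivAt cschReg (cschRegDeriv x) x := by
  have hs : sinh x ≠ 0 := (sinh_pos_iff.2 hx).ne'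
  have h := ((hasDerivAt_sinh x).inv hs).sub (hasDerivAt_inv hx.ne')
  have e : cschReg = sinh⁻¹ - Inv.inv := by
    ext y; simp [cschReg]
  rw [e]
  refine h.congr_deriv ?_
  unfold cschRegDeriv
  field_simp
  ring

lemma hasDerivAt_cschRegDeriv {x : ℝ} (hx : 0 < x) :
    HasDerivAt cschRegDeriv (cschRegDeriv₂ x) x := by
  have hs : sinh x ≠ 0 := (sinh_pos_iff.2 hx).ne'
  have h := ((hasDerivAt_const x (1 : ℝ)).div (hasDerivAt_pow 2 x) (by positivity)).sub
    ((hasDerivAt_cosh x).div ((hasDerivAt_sinh x).pow 2) (pow_ne_zero 2 hs))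
  refine h.congr_deriv ?_
  unfold cschRegDeriv₂
  have hc := cosh_sq x
  simp
  field_simp
  rw [hc]
  ring

lemma abs_sinh_sub_cubic_le {x : ℝ} (hx : 0 ≤ x) (hx1 : x ≤ 1) :
    |sinh x - (x + x ^ 3 / 6)| ≤ x ^ 5 / 100 := by
  have h1 := exp_bound (x := x) (by rwa [abs_of_nonneg hx]) (n := 5) (by norm_num)
  have h2 := exp_bound (x := -x) (by rwa [abs_neg, abs_of_nonneg hx]) (n := 5) (by norm_num)
  rw [abs_neg] at h2
  rw [abs_of_nonneg hx] at h1 h2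
  simp [Finset.sum_range_succ, Nat.factorial] at h1 h2
  rw [abs_le] at *
  rw [sinh_eq]
  constructor <;> linarith [h1.1, h1.2, h2.1, h2.2]

lemma abs_cschReg_le {x : ℝ} (hx : 0 < x) (hx1 : x ≤ 1) : |cschReg x| ≤ x / 5 := by
  have hb := abs_le.1 (abs_sinh_sub_cubic_le hx.le hx1)
  have hs := self_le_sinh_iff.2 hx.le
  have hs0 := sinh_pos_iff.2 hx
  have h5 : x ^ 5 ≤ x ^ 3 := pow_le_pow_of_le_one hx.le hx1 (by norm_num)
  have e : cschReg x = -((sinh x - x) / (sinh x * x)) := by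
    unfold cschReg; field_simp; ring
  rw [e, abs_neg, abs_of_nonneg (div_nonneg (by linarith) (by positivity)),
    div_le_iff₀ (by positivity)]
  have : x / 5 * (x * x) ≤ x / 5 * (sinh x * x) := by gcongr
  nlinarith [pow_pos hx 3]

lemma abs_cschRegDeriv₂_le_of_le_one {x : ℝ} (hx : 0 < x) (hx1 : x ≤ 1) :
    |cschRegDeriv₂ x| ≤ 2 := by
  have hb := abs_sinh_sub_cubic_le hx.le hx1
  have hs := self_le_sinh_iff.2 hx.le
  have hs0 := sinh_pos_iff.2 hx
  obtain ⟨r, hr⟩ : ∃ r, sinh x = x * (1 + x ^ 2 * (1 / 6 + x ^ 2 * r)) :=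
    ⟨(sinh x - (x + x ^ 3 / 6)) / x ^ 5, by field_simp; ring⟩
  have hr1 : |r| ≤ 1 / 100 := by
    rw [hr, show x * (1 + x ^ 2 * (1 / 6 + x ^ 2 * r)) - (x + x ^ 3 / 6) = x ^ 5 * r by ring,
      abs_mul, abs_of_nonneg (by positivity)] at hb
    exact le_of_mul_le_mul_left (by linarith) (pow_pos hx 5)
  set q := 1 / 6 + x ^ 2 * r with hq
  have hx2 : x ^ 2 ≤ 1 := by nlinarith
  have hxr : |x ^ 2 * r| ≤ 1 / 100 := by
    rw [abs_mul, abs_of_nonneg (sq_nonneg x)]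
    nlinarith [abs_nonneg r, sq_nonneg x]
  have hq0 : 0 ≤ q := by linarith [(abs_le.1 hxr).1]
  have hq1 : q ≤ 1 / 5 := by linarith [(abs_le.1 hxr).2]
  have hu : 1 ≤ 1 + x ^ 2 * q := by nlinarith [sq_nonneg x]
  have e : cschRegDeriv₂ x = -(x * (6 * r + 6 * q ^ 2 + 2 * x ^ 2 * q ^ 3 - 2 * q - x ^ 2 * q ^ 2)
      / (1 + x ^ 2 * q) ^ 3) := by
    unfold cschRegDeriv₂
    rw [hr]
    have : 1 + x ^ 2 * q ≠ 0 := by positivity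
    field_simp
    rw [hq]
    ring
  have hq2 : q ^ 2 ≤ 1 / 25 := by nlinarith
  have hq3 : q ^ 3 ≤ 1 / 125 := by
    calc q ^ 3 ≤ (1 / 5) ^ 3 := by gcongr
      _ = _ := by norm_num
  have hA : |6 * r + 6 * q ^ 2 + 2 * x ^ 2 * q ^ 3 - 2 * q - x ^ 2 * q ^ 2| ≤ 2 := by
    have := abs_le.1 hr1
    have h1 : x ^ 2 * q ^ 3 ≤ 1 * (1 / 125) := by gcongr
    have h2 : x ^ 2 * q ^ 2 ≤ 1 * (1 / 25) := by gcongr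
    have h3 : 0 ≤ x ^ 2 * q ^ 3 := by positivity
    have h4 : 0 ≤ x ^ 2 * q ^ 2 := by positivity
    rw [abs_le]
    constructor <;> nlinarith
  rw [e, abs_neg, abs_div, abs_of_pos (show 0 < (1 + x ^ 2 * q) ^ 3 by positivity),
    div_le_iff₀ (by positivity), abs_mul, abs_of_pos hx]
  have h3 : 1 ≤ (1 + x ^ 2 * q) ^ 3 := one_le_pow₀ hu
  nlinarith [abs_nonneg (6 * r + 6 * q ^ 2 + 2 * x ^ 2 * q ^ 3 - 2 * q - x ^ 2 * q ^ 2)]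

lemma abs_cschRegDeriv₂_le_of_one_le {x : ℝ} (hx1 : 1 ≤ x) :
    |cschRegDeriv₂ x| ≤ 4 / x ^ 2 := by
  have hx : 0 < x := by linarith
  have hs := self_le_sinh_iff.2 hx.le
  have hs0 := sinh_pos_iff.2 hx
  have hS : x ^ 2 / 4 ≤ sinh x := by
    have h1 := quadratic_le_exp_of_nonneg hx.le
    have h2 : exp (-x) ≤ 1 := exp_le_one_iff.2 (by linarith)
    rw [sinh_eq]
    linarith
  have e : cschRegDeriv₂ x = 2 / sinh x ^ 3 + 1 / sinh x - 2 / x ^ 3 := by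
    unfold cschRegDeriv₂; field_simp
  have h1 : 2 / sinh x ^ 3 ≤ 2 / x ^ 3 := by gcongr
  have h2 : 1 / sinh x ≤ 4 / x ^ 2 := by
    rw [div_le_div_iff₀ hs0 (by positivity)]; linarith
  have h3 : 2 / x ^ 3 ≤ 4 / x ^ 2 := by
    rw [div_le_div_iff₀ (by positivity) (by positivity)]
    nlinarith [sq_nonneg x]
  have h4 : 0 ≤ 2 / sinh x ^ 3 := by positivity
  have h5 : 0 ≤ 1 / sinh x := by positivity
  rw [e, abs_le]
  constructor <;> linarith

lemma abs_cschRegDeriv₂_le {x : ℝ} (hx : 0 < x) : |cschRegDeriv₂ x| ≤ 16 / (1 + x) ^ 2 := by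
  rcases le_total x 1 with h | h
  · refine (abs_cschRegDeriv₂_le_of_le_one hx h).trans ?_
    rw [le_div_iff₀ (by positivity)]
    nlinarith
  · refine (abs_cschRegDeriv₂_le_of_one_le h).trans ?_
    rw [div_le_div_iff₀ (by positivity) (by positivity)]
    nlinarith

lemma abs_cschRegPrim_add_log_two_le {s : ℝ} (hs : 0 < s) (hs1 : s ≤ 1) :
    |cschRegPrim s + log 2| ≤ s ^ 2 := by
  have hb := exp_bound (x := s) (by rwa [abs_of_pos hs]) (n := 3) (by norm_num)
  rw [abs_of_pos hs] at hb
  simp [Finset.sum_range_succ, Nat.factorial] at hb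
  have hb := abs_le.1 hb
  have h1 : 1 < exp s := one_lt_exp_iff.2 hs
  have h1' : 0 < exp s - 1 := by linarith
  set δ := 2 * (exp s - 1) / (s * (exp s + 1)) - 1 with hδ
  have hlog : cschRegPrim s + log 2 = log (1 + δ) := by
    rw [hδ, add_sub_cancel, log_div (by positivity) (by positivity),
      log_mul (by positivity) (by positivity), log_mul (by positivity) (by positivity)]
    unfold cschRegPrim cschPrim
    ring
  have hd : |δ| ≤ s ^ 2 / 2 := by
    have e : δ = (2 * (exp s - 1) - s * (exp s + 1)) / (s * (exp s + 1)) := by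
      rw [hδ]; field_simp
    rw [e, abs_div, abs_of_pos (show 0 < s * (exp s + 1) by positivity),
      div_le_iff₀ (by positivity)]
    have h3 : |2 * (exp s - 1) - s * (exp s + 1)| ≤ s ^ 3 := by
      have hs3 := pow_pos hs 3
      rw [abs_le]
      constructor <;> nlinarith
    have h4 : s ^ 2 / 2 * (s * 2) ≤ s ^ 2 / 2 * (s * (exp s + 1)) := by gcongr; linarith
    nlinarith
  have hd' := abs_le.1 hd
  have hs2 : s ^ 2 ≤ 1 := by nlinarith
  have hpos : 0 < 1 + δ := by linarith
  rw [hlog, abs_le]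
  constructor
  · refine le_trans ?_ (one_sub_inv_le_log_of_pos hpos)
    have : (1 + δ)⁻¹ ≤ 1 + s ^ 2 := by
      rw [inv_le_iff_one_le_mul₀ hpos]
      nlinarith [sq_nonneg s]
    linarith
  · have := log_le_sub_one_of_pos hpos
    nlinarith
lemma abs_sub_le_of_hasDerivAt {f f' : ℝ → ℝ} {a s C x : ℝ}
    (hf : ∀ y ∈ Set.Icc a (a + s), HasDerivAt f (f' y) y)
    (hC : ∀ y ∈ Set.Icc a (a + s), |f' y| ≤ C) (hx : x ∈ Set.Icc a (a + s)) :
    |f x - f a| ≤ C * s := by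
  have h := (convex_Icc a (a + s)).norm_image_sub_le_of_norm_hasDerivWithin_le
    (fun y hy => (hf y hy).hasDerivWithinAt) hC ⟨le_rfl, hx.1.trans hx.2⟩ hx
  have hC0 : 0 ≤ C := (abs_nonneg _).trans (hC x hx)
  rw [norm_eq_abs, norm_eq_abs, abs_of_nonneg (sub_nonneg.2 hx.1)] at h
  exact h.trans (mul_le_mul_of_nonneg_left (by linarith [hx.2]) hC0)

/-- A one-point quadrature rule with an endpoint correction is accurate to third order. -/
lemma abs_quadrature_error_le {F f f' f'' : ℝ → ℝ} {a s K θ : ℝ} (hs : 0 ≤ s)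
    (hθ : 0 ≤ θ) (hθ1 : θ ≤ 1)
    (hF : ∀ y ∈ Set.Icc a (a + s), HasDerivAt F (f y) y)
    (hf : ∀ y ∈ Set.Icc a (a + s), HasDerivAt f (f' y) y)
    (hf' : ∀ y ∈ Set.Icc a (a + s), HasDerivAt f' (f'' y) y)
    (hK : ∀ y ∈ Set.Icc a (a + s), |f'' y| ≤ K) :
    |s * f (a + θ * s) - (F (a + s) - F a) - (θ - 1 / 2) * s * (f (a + s) - f a)|
      ≤ 3 * K * s ^ 3 := by
  have h1 : ∀ y ∈ Set.Icc a (a + s), |f' y - f' a| ≤ K * s :=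
    fun y hy => abs_sub_le_of_hasDerivAt hf' hK hy
  have h2 : ∀ y ∈ Set.Icc a (a + s), |f y - f a - f' a * (y - a)| ≤ K * s * s := by
    intro y hy
    have := abs_sub_le_of_hasDerivAt (f := fun y => f y - f' a * y)
      (f' := fun y => f' y - f' a)
      (fun z hz => ((hf z hz).sub ((hasDerivAt_id z).const_mul (f' a))).congr_deriv (by ring))
      h1 hy
    convert this using 2
    ring
  have hend : a + s ∈ Set.Icc a (a + s) := ⟨by linarith, le_rfl⟩
  have h3 : |F (a + s) - F a - f a * s - f' a * s ^ 2 / 2| ≤ K * s * s * s := by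
    have := abs_sub_le_of_hasDerivAt (f := fun y => F y - f a * y - f' a * (y - a) ^ 2 / 2)
      (f' := fun y => f y - f a - f' a * (y - a))
      (fun z hz => by
        refine (((hF z hz).sub ((hasDerivAt_id z).const_mul (f a))).sub
          (((((hasDerivAt_id z).sub_const a).pow 2).const_mul (f' a)).div_const 2)).congr_deriv ?_
        simp
        ring) h2 hend
    convert this using 2
    ring
  have h4 := h2 (a + θ * s) ⟨by nlinarith, by nlinarith⟩
  have h5 := h2 (a + s) hend
  have e : s * f (a + θ * s) - (F (a + s) - F a) - (θ - 1 / 2) * s * (f (a + s) - f a)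
      = s * (f (a + θ * s) - f a - f' a * (a + θ * s - a))
        - (F (a + s) - F a - f a * s - f' a * s ^ 2 / 2)
        - (θ - 1 / 2) * s * (f (a + s) - f a - f' a * (a + s - a)) := by ring
  have h6 : |s * (f (a + θ * s) - f a - f' a * (a + θ * s - a))| ≤ s * (K * s * s) := by
    rw [abs_mul, abs_of_nonneg hs]; gcongr
  have h7 : |(θ - 1 / 2) * s * (f (a + s) - f a - f' a * (a + s - a))| ≤ 1 * s * (K * s * s) := by
    rw [abs_mul, abs_mul, abs_of_nonneg hs]
    gcongr
    rw [abs_le]; constructor <;> linarith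
  rw [e]
  rw [abs_le] at *
  constructor <;> nlinarith

lemma abs_cschReg_quadrature_error_le {a s θ : ℝ} (ha : 0 < a) (hs : 0 ≤ s)
    (hθ : 0 ≤ θ) (hθ1 : θ ≤ 1) :
    |s * cschReg (a + θ * s) - (cschRegPrim (a + s) - cschRegPrim a)
      - (θ - 1 / 2) * s * (cschReg (a + s) - cschReg a)| ≤ 48 * s ^ 3 / (1 + a) ^ 2 := by
  have hp : ∀ y ∈ Set.Icc a (a + s), 0 < y := fun y hy => ha.trans_le hy.1
  have h := abs_quadrature_error_le (K := 16 / (1 + a) ^ 2) hs hθ hθ1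
    (fun y hy => hasDerivAt_cschRegPrim (hp y hy)) (fun y hy => hasDerivAt_cschReg (hp y hy))
    (fun y hy => hasDerivAt_cschRegDeriv (hp y hy))
    (fun y hy => (abs_cschRegDeriv₂_le (hp y hy)).trans (by have := hy.1; gcongr))
  refine h.trans (le_of_eq ?_)
  ring

lemma abs_sum_cschReg_sub_le {s θ : ℝ} (hs : 0 < s) (hs1 : s ≤ 1) (hθ : 0 < θ) (hθ1 : θ ≤ 1)
    (N : ℕ) :
    |∑ k ∈ Finset.range (N + 1), s * cschReg ((k + θ) * s) - (cschRegPrim ((N + 1) * s) + log 2)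
      - (θ - 1 / 2) * s * cschReg ((N + 1) * s)|
      ≤ 2 * s ^ 2 + 48 * s ^ 2 * (1 - 1 / (1 + N * s)) := by
  induction N with
  | zero =>
    have h1 := abs_cschReg_le (x := θ * s) (by positivity) (by nlinarith)
    have h2 := abs_cschReg_le hs hs1
    have h3 := abs_cschRegPrim_add_log_two_le hs hs1
    have h4 : |s * cschReg (θ * s)| ≤ s * (s / 5) := by
      rw [abs_mul, abs_of_pos hs]
      refine mul_le_mul_of_nonneg_left (h1.trans ?_) hs.le
      nlinarith
    have h5 : |(θ - 1 / 2) * s * cschReg s| ≤ 1 * s * (s / 5) := by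
      rw [abs_mul, abs_mul, abs_of_pos hs]
      gcongr
      rw [abs_le]; constructor <;> linarith
    simp only [zero_add, Finset.sum_range_one, Nat.cast_zero, one_mul, zero_mul, add_zero]
    rw [abs_le] at *
    constructor <;> nlinarith
  | succ N ih =>
    have h := abs_cschReg_quadrature_error_le (a := (N + 1) * s) (by positivity) hs.le hθ.le hθ1
    have hb : 48 * s ^ 3 / (1 + (N + 1) * s) ^ 2
        ≤ 48 * s ^ 2 * (1 / (1 + N * s) - 1 / (1 + (N + 1) * s)) := by
      have e : 48 * s ^ 2 * (1 / (1 + N * s) - 1 / (1 + (N + 1) * s))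
          = 48 * s ^ 3 / ((1 + N * s) * (1 + (N + 1) * s)) := by
        field_simp; ring
      rw [e, sq]
      gcongr
      linarith
    rw [Finset.sum_range_succ]
    push_cast
    rw [show ((N : ℝ) + 1) * s + θ * s = (N + 1 + θ) * s by ring,
      show ((N : ℝ) + 1) * s + s = (N + 1 + 1) * s by ring] at h
    rw [abs_le] at *
    constructor <;> nlinarith

lemma hasSum_exp_neg_odd_mul {y : ℝ} (hy : 0 < y) :
    HasSum (fun n : ℕ => exp (-((2 * n + 1) * y))) (1 / (2 * sinh y)) := by
  have h := (hasSum_geometric_of_lt_one (exp_nonneg (-(2 * y)))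
    (exp_lt_one_iff.2 (by linarith))).mul_left (exp (-y))
  have e1 : (fun n : ℕ => exp (-((2 * n + 1) * y)))
      = fun n : ℕ => exp (-y) * exp (-(2 * y)) ^ n := by
    ext n
    rw [← exp_nat_mul, ← exp_add]
    ring_nf
  have e2 : 1 / (2 * sinh y) = exp (-y) * (1 - exp (-(2 * y)))⁻¹ := by
    have h1 : 1 < exp y := one_lt_exp_iff.2 hy
    have h2 : exp y ^ 2 - 1 ≠ 0 := by nlinarith
    rw [sinh_eq, show -(2 * y) = -y + -y by ring, exp_add, exp_neg]
    field_simp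
  rwa [e1, e2]

lemma hasSum_exp_neg_shift_mul {s θ x : ℝ} (hs : 0 < s) (hx : 0 < x) :
    HasSum (fun k : ℕ => exp (-(x * ((k + θ) * s))))
      (exp (x * ((1 - θ) * s)) / (exp (x * s) - 1)) := by
  have hxs : 0 < x * s := mul_pos hx hs
  have h := (hasSum_geometric_of_lt_one (exp_nonneg (-(x * s)))
    (exp_lt_one_iff.2 (by linarith))).mul_left (exp (-(x * θ * s)))
  have e1 : (fun k : ℕ => exp (-(x * ((k + θ) * s))))
      = fun k : ℕ => exp (-(x * θ * s)) * exp (-(x * s)) ^ k := by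
    ext n
    rw [← exp_nat_mul, ← exp_add]
    ring_nf
  have e2 : exp (x * ((1 - θ) * s)) / (exp (x * s) - 1)
      = exp (-(x * θ * s)) * (1 - exp (-(x * s)))⁻¹ := by
    have h1 : 1 < exp (x * s) := one_lt_exp_iff.2 hxs
    have h2 : exp (x * s) - 1 ≠ 0 := by linarith
    rw [show x * ((1 - θ) * s) = -(x * θ * s) + x * s by ring, exp_add, exp_neg (x * s)]
    field_simp
  rwa [e1, e2]

lemma summable_csch {s θ : ℝ} (hs : 0 < s) (hθ : 0 < θ) :
    Summable (fun k : ℕ => 1 / (2 * sinh ((k + θ) * s))) := by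
  have hx : exp (-(1 * s)) < 1 := exp_lt_one_iff.2 (by linarith)
  have hc : 0 < 1 - exp (-(2 * (θ * s))) :=
    sub_pos.2 (exp_lt_one_iff.2 (by have := mul_pos hθ hs; linarith))
  have hg := ((hasSum_exp_neg_shift_mul (θ := θ) hs one_pos).summable).mul_right
    (1 - exp (-(2 * (θ * s))))⁻¹
  refine Summable.of_nonneg_of_le (fun k => ?_) (fun k => ?_) hg
  · have : 0 < sinh ((k + θ) * s) := sinh_pos_iff.2 (by positivity)
    positivity
  · have hp : 0 < sinh ((k + θ) * s) := sinh_pos_iff.2 (by positivity)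
    rw [one_mul, ← div_eq_mul_inv, div_le_div_iff₀ (by positivity) hc, one_mul]
    have e : exp (-((k + θ) * s)) * (2 * sinh ((k + θ) * s))
        = 1 - exp (-(2 * ((k + θ) * s))) := by
      rw [sinh_eq, show -(2 * ((k + θ) * s)) = -((k + θ) * s) + -((k + θ) * s) by ring, exp_add,
        exp_neg]
      field_simp
    rw [e]
    gcongr
    have : (0 : ℝ) ≤ k := k.cast_nonneg
    linarith

lemma hasSum_csch {s θ : ℝ} (hs : 0 < s) (hθ : 0 < θ) :
    HasSum (fun k : ℕ => 1 / (2 * sinh ((k + θ) * s))) (U s ((1 - θ) * s)) := by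
  have hn : ∀ k : ℕ, HasSum (fun n : ℕ => exp (-((2 * n + 1) * ((k + θ) * s))))
      (1 / (2 * sinh ((k + θ) * s))) := fun k => hasSum_exp_neg_odd_mul (by positivity)
  have hsum : Summable (Function.uncurry
      fun k n : ℕ => exp (-((2 * n + 1) * ((k + θ) * s)))) := by
    refine (summable_prod_of_nonneg fun p => exp_nonneg _).2 ?_
    refine ⟨fun k => (hn k).summable, ?_⟩
    simpa only [Function.uncurry_apply_pair, (hn _).tsum_eq] using summable_csch hs hθ
  have h := hsum.tsum_comm
  simp only [(hn _).tsum_eq] at h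
  have e : U s ((1 - θ) * s) = ∑' k : ℕ, 1 / (2 * sinh ((k + θ) * s)) := by
    rw [← h]
    exact tsum_congr fun n => (hasSum_exp_neg_shift_mul hs (by positivity)).tsum_eq.symm
  rw [e]
  exact (summable_csch hs hθ).hasSum

lemma summable_digammaVal {z : ℝ} (hz : 0 < z) (hz1 : z ≤ 1) :
    Summable (fun k : ℕ => (z - 1) / (((k : ℝ) + 1) * (k + z))) := by
  have h2 : Summable fun k : ℕ => 1 / ((k + 1 : ℕ) : ℝ) ^ 2 :=
    (summable_nat_add_iff 1).2 (summable_one_div_nat_pow.2 (by norm_num))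
  refine Summable.of_norm_bounded (h2.mul_left z⁻¹) fun k => ?_
  push_cast
  have hk : (0 : ℝ) ≤ k := k.cast_nonneg
  rw [norm_eq_abs, abs_div, abs_of_nonpos (by linarith : z - 1 ≤ 0),
    abs_of_pos (by positivity : (0 : ℝ) < (k + 1) * (k + z)), ← div_eq_inv_mul, div_div,
    div_le_div_iff₀ (by positivity) (by positivity)]
  have h : ((k : ℝ) + 1) * (((k : ℝ) + 1) * z) ≤ (k + 1) * (k + z) := by
    gcongr
    nlinarith
  nlinarith [mul_nonneg hz.le (by positivity : (0 : ℝ) ≤ (k + 1) * ((k + 1) * z))]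

lemma tendsto_cschPrim_atTop : Filter.Tendsto cschPrim Filter.atTop (nhds 0) := by
  have h1 : Filter.Tendsto (fun x : ℝ => 1 - 2 / (exp x + 1)) Filter.atTop (nhds (1 - 0)) :=
    ((Filter.tendsto_atTop_add_const_right _ 1 tendsto_exp_atTop).const_div_atTop 2).const_sub 1
  have h2 := h1.log (by norm_num)
  rw [sub_zero, log_one] at h2
  refine h2.congr' ?_
  filter_upwards [Filter.eventually_gt_atTop 0] with x hx
  have h3 : 1 < exp x := one_lt_exp_iff.2 hx
  rw [cschPrim, ← log_div (by linarith) (by linarith)]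
  congr 1
  field_simp
  ring

lemma tendsto_cschReg_atTop : Filter.Tendsto cschReg Filter.atTop (nhds 0) := by
  have h1 : Filter.Tendsto sinh Filter.atTop Filter.atTop :=
    Filter.tendsto_atTop_mono' _
      (by filter_upwards [Filter.eventually_ge_atTop 0] with x hx using self_le_sinh_iff.2 hx)
      Filter.tendsto_id
  simpa [show cschReg = fun x => 1 / sinh x - 1 / x from rfl] using (h1.const_div_atTop 1).sub (Filter.tendsto_id.const_div_atTop (1 : ℝ))

lemma tendsto_sum_cschReg {s θ : ℝ} (hs : 0 < s) (hθ : 0 < θ) (hθ1 : θ ≤ 1) :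
    Filter.Tendsto (fun N : ℕ => ∑ k ∈ Finset.range (N + 1), s * cschReg ((k + θ) * s)
      - (cschRegPrim ((N + 1) * s) + log 2) - (θ - 1 / 2) * s * cschReg ((N + 1) * s))
      Filter.atTop (nhds (2 * s * U s ((1 - θ) * s) - (log (2 / s) - digammaVal θ))) := by
  have hshift := Filter.tendsto_add_atTop_nat 1
  have hX : Filter.Tendsto (fun N : ℕ => ((N : ℝ) + 1) * s) Filter.atTop Filter.atTop :=
    (Filter.tendsto_atTop_add_const_right _ 1 tendsto_natCast_atTop_atTop).atTop_mul_const hs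
  have h1 := ((hasSum_csch hs hθ).mul_left (2 * s)).tendsto_sum_nat.comp hshift
  have h2 := (summable_digammaVal hθ hθ1).hasSum.tendsto_sum_nat.comp hshift
  have h3 := tendsto_harmonic_sub_log.comp hshift
  have h4 := tendsto_cschPrim_atTop.comp hX
  have h5 := (tendsto_cschReg_atTop.comp hX).const_mul ((θ - 1 / 2) * s)
  have h := (((((h1.sub h3).add h2).sub h4).sub h5).add_const (log s)).sub_const (log 2)
  have e : 2 * s * U s ((1 - θ) * s) - (log (2 / s) - digammaVal θ)
      = 2 * s * U s ((1 - θ) * s) - eulerMascheroniConstant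
        + ∑' k : ℕ, (θ - 1) / (((k : ℝ) + 1) * (k + θ)) - 0 - (θ - 1 / 2) * s * 0
        + log s - log 2 := by
    rw [log_div (by norm_num) hs.ne', digammaVal]
    ring
  rw [e]
  refine h.congr fun N => ?_
  simp only [Function.comp_apply, cschRegPrim, harmonic, Rat.cast_sum]
  have hsum : ∑ k ∈ Finset.range (N + 1), s * cschReg ((k + θ) * s)
      = ∑ k ∈ Finset.range (N + 1), 2 * s * (1 / (2 * sinh ((k + θ) * s)))
        - ∑ k ∈ Finset.range (N + 1), (((k + 1 : ℕ) : ℚ)⁻¹ : ℚ)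
        + ∑ k ∈ Finset.range (N + 1), (θ - 1) / (((k : ℝ) + 1) * (k + θ)) := by
    rw [Rat.cast_sum, ← Finset.sum_sub_distrib, ← Finset.sum_add_distrib]
    refine Finset.sum_congr rfl fun k _ => ?_
    have hp : 0 < sinh ((k + θ) * s) := sinh_pos_iff.2 (by positivity)
    have hk : (k : ℝ) + θ ≠ 0 := by positivity
    push_cast
    unfold cschReg
    field_simp
    ring
  rw [hsum, log_mul (by positivity) hs.ne', Rat.cast_sum]
  push_cast
  ring

lemma abs_U_sub_le {s θ : ℝ} (hs : 0 < s) (hs1 : s ≤ 1) (hθ : 0 < θ) (hθ1 : θ ≤ 1) :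
    |U s ((1 - θ) * s) - 1 / (2 * s) * (log (2 / s) - digammaVal θ)| ≤ 25 * s := by
  have h : |2 * s * U s ((1 - θ) * s) - (log (2 / s) - digammaVal θ)| ≤ 50 * s ^ 2 := by
    refine le_of_tendsto (tendsto_sum_cschReg hs hθ hθ1).abs (Filter.Eventually.of_forall ?_)
    intro N
    refine (abs_sum_cschReg_sub_le hs hs1 hθ hθ1 N).trans ?_
    have : 0 ≤ 48 * s ^ 2 * (1 / (1 + N * s)) := by positivity
    linarith
  have e : U s ((1 - θ) * s) - 1 / (2 * s) * (log (2 / s) - digammaVal θ)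
      = (2 * s * U s ((1 - θ) * s) - (log (2 / s) - digammaVal θ)) / (2 * s) := by
    field_simp
  rw [e, abs_div, abs_of_pos (show 0 < 2 * s by positivity), div_le_iff₀ (by positivity)]
  linarith

lemma xi_pos {r r₁ r₂ ε : ℝ} (hr : 0 < r) (hr₁ : 0 < r₁) (hr₂ : 0 < r₂) (hε : 0 < ε) :
    0 < xi r r₁ r₂ ε := by
  unfold xi aEps
  rw [arsinh_pos_iff]
  positivity

lemma arsinh_le_self {x : ℝ} (hx : 0 ≤ x) : arsinh x ≤ x := by
  have := self_le_sinh_iff.2 (arsinh_nonneg_iff.2 hx)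
  rwa [sinh_arsinh] at this

lemma xi_le {r r₁ r₂ ε : ℝ} (hr : 0 < r) (hr₁ : 0 < r₁) (hr₂ : 0 < r₂) (hε : 0 < ε)
    (hε1 : ε ≤ 1) :
    xi r r₁ r₂ ε ≤
      √((2 * r₁ + 1) * (2 * r₂ + 1) * (2 * r₁ + 2 * r₂ + 1)) / (2 * (r₁ + r₂)) / r * √ε := by
  refine (arsinh_le_self (by unfold aEps; positivity)).trans ?_
  rw [div_mul_eq_mul_div, div_mul_eq_mul_div, mul_comm (√_) (√ε)]
  have h : 2 * (r₁ + r₂) ≤ 2 * (r₁ + r₂ + ε) := by linarith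
  unfold aEps
  gcongr

theorem stmt4 (r₁ r₂ : ℝ) (hr₁ : 0 < r₁) (hr₂ : 0 < r₂) :
    ∃ C > 0, ∃ ε₀ > 0, ∀ ε ∈ Set.Ioo 0 ε₀,
      (∀ j : Fin 2,
        |U (xi r₁ r₁ r₂ ε + xi r₂ r₁ r₂ ε) (xi (if j = 0 then r₁ else r₂) r₁ r₂ ε) -
          (1 / (2 * (xi r₁ r₁ r₂ ε + xi r₂ r₁ r₂ ε))) *
            (Real.log (2 / (xi r₁ r₁ r₂ ε + xi r₂ r₁ r₂ ε)) -
              digammaVal (1 - (xi (if j = 0 then r₁ else r₂) r₁ r₂ ε) /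
                (xi r₁ r₁ r₂ ε + xi r₂ r₁ r₂ ε)))| ≤ C * Real.sqrt ε) ∧
      |U (xi r₁ r₁ r₂ ε + xi r₂ r₁ r₂ ε) 0 -
        (1 / (2 * (xi r₁ r₁ r₂ ε + xi r₂ r₁ r₂ ε))) *
          (Real.log (2 / (xi r₁ r₁ r₂ ε + xi r₂ r₁ r₂ ε)) +
            Real.eulerMascheroniConstant)| ≤ C * Real.sqrt ε := by
  set A := √((2 * r₁ + 1) * (2 * r₂ + 1) * (2 * r₁ + 2 * r₂ + 1)) / (2 * (r₁ + r₂)) with hA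
  have hA0 : 0 < A := by positivity
  set B := A / r₁ + A / r₂ with hB
  have hB0 : 0 < B := by positivity
  refine ⟨25 * B, by positivity, min 1 (1 / B ^ 2), by positivity, ?_⟩
  rintro ε ⟨hε, hlt⟩
  have hε1 : ε ≤ 1 := hlt.le.trans (min_le_left _ _)
  have hx₁ := xi_pos hr₁ hr₁ hr₂ hε
  have hx₂ := xi_pos hr₂ hr₁ hr₂ hε
  have hle : xi r₁ r₁ r₂ ε + xi r₂ r₁ r₂ ε ≤ B * √ε := by
    rw [hB, add_mul]
    exact add_le_add (xi_le hr₁ hr₁ hr₂ hε hε1) (xi_le hr₂ hr₁ hr₂ hε hε1)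
  have hBε : B * √ε ≤ 1 := by
    have h1 : √ε ≤ 1 / B := by
      rw [sqrt_le_left (by positivity), div_pow, one_pow]
      exact hlt.le.trans (min_le_right _ _)
    rwa [le_div_iff₀ hB0, mul_comm] at h1
  have hj : ∀ j : Fin 2, 0 < xi (if j = 0 then r₁ else r₂) r₁ r₂ ε ∧
      xi (if j = 0 then r₁ else r₂) r₁ r₂ ε < xi r₁ r₁ r₂ ε + xi r₂ r₁ r₂ ε := by
    intro j
    split_ifs
    · exact ⟨hx₁, by linarith⟩
    · exact ⟨hx₂, by linarith⟩
  set s := xi r₁ r₁ r₂ ε + xi r₂ r₁ r₂ ε with hs_def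
  have hs : 0 < s := by positivity
  have key : ∀ c : ℝ, 0 ≤ c → c < s →
      |U s c - 1 / (2 * s) * (log (2 / s) - digammaVal (1 - c / s))| ≤ 25 * B * √ε := by
    intro c hc hcs
    have h := abs_U_sub_le (θ := 1 - c / s) hs (hle.trans hBε)
      (by rw [sub_pos, div_lt_one hs]; exact hcs) (by linarith [div_nonneg hc hs.le])
    rw [show (1 - (1 - c / s)) * s = c by field_simp; ring] at h
    linarith
  refine ⟨fun j => key _ (hj j).1.le (hj j).2, ?_⟩
  simpa [digammaVal] using key 0 le_rfl hs

end
end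

section
/- There exist C > 0 and ε₀ > 0 such that for all ε ∈ (0, ε₀) and each c ∈ {ξ₁, ξ₂, ξ₁+ξ₂}: |∑_{m=0}^∞ q_m^c·f(a_ε·coth ξ_m^c) − ∑_{m=0}^∞ (4π a_ε/ξ_m^c)·f(a_ε/ξ_m^c)| ≤ C·ε·|ln ε|, where ξ_m^c = m·s₀ + c and q_m^c = 4π a_ε/sinh(ξ_m^c). The constant C may depend on r₁, r₂ and f but not on ε. -/
open Real

noncomputable section

/-- The hyperbolic cotangent. -/
def coth (x : ℝ) : ℝ := Real.cosh x / Real.sinh x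

theorem sinh_le_self_mul_cosh {x : ℝ} (hx : 0 ≤ x) : Real.sinh x ≤ x * Real.cosh x := by
  have hd : ∀ y : ℝ, HasDerivAt (fun y : ℝ => y * Real.cosh y - Real.sinh y)
      (y * Real.sinh y) y := by
    intro y
    have := ((hasDerivAt_id' y).mul (Real.hasDerivAt_cosh y)).sub (Real.hasDerivAt_sinh y)
    exact this.congr_deriv (by ring)
  have hmono : MonotoneOn (fun y : ℝ => y * Real.cosh y - Real.sinh y) (Set.Ici 0) := by
    refine monotoneOn_of_deriv_nonneg (convex_Ici 0) (by fun_prop)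
      (fun y _ => (hd y).differentiableAt.differentiableWithinAt) fun y hy => ?_
    rw [(hd y).deriv]
    rw [interior_Ici] at hy
    exact mul_nonneg (le_of_lt hy) (Real.sinh_nonneg_iff.2 (le_of_lt hy))
  have := hmono Set.self_mem_Ici hx hx
  simp only [zero_mul, Real.sinh_zero, sub_zero] at this
  linarith

theorem sinh_eq_half (x : ℝ) : Real.sinh x = 2 * Real.sinh (x / 2) * Real.cosh (x / 2) := by
  rw [← Real.sinh_two_mul, mul_div_cancel₀ x two_ne_zero]

theorem cosh_sub_one_le {x : ℝ} (hx : 0 ≤ x) : Real.cosh x - 1 ≤ x * Real.sinh x := by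
  have h := sinh_le_self_mul_cosh (div_nonneg hx zero_le_two)
  have h0 : 0 ≤ Real.sinh (x / 2) := Real.sinh_nonneg_iff.2 (div_nonneg hx zero_le_two)
  have hc : Real.cosh x = 1 + 2 * Real.sinh (x / 2) ^ 2 := by
    have := Real.cosh_two_mul (x / 2)
    rw [mul_div_cancel₀ x two_ne_zero, Real.cosh_sq'] at this
    linarith
  have hc0 := mul_nonneg hx (Real.cosh_pos (x / 2)).le
  rw [hc, sinh_eq_half x]
  nlinarith [mul_le_mul_of_nonneg_right h h0, mul_nonneg hc0 h0]

theorem sq_half_le_sinh {x : ℝ} (hx : 0 ≤ x) : x ^ 2 / 2 ≤ Real.sinh x := by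
  have h1 : x / 2 ≤ Real.sinh (x / 2) := Real.self_le_sinh_iff.2 (by linarith)
  have h2 : Real.sinh (x / 2) ≤ Real.cosh (x / 2) := (Real.sinh_lt_cosh _).le
  rw [sinh_eq_half]
  nlinarith

section Pointwise

variable {x : ℝ}

theorem inv_sinh_le_inv (hx : 0 < x) : (Real.sinh x)⁻¹ ≤ x⁻¹ :=
  inv_anti₀ hx (Real.self_le_sinh_iff.2 hx.le)

theorem inv_sinh_le_two_mul_inv_sq (hx : 0 < x) : (Real.sinh x)⁻¹ ≤ 2 * x⁻¹ ^ 2 := by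
  have := inv_anti₀ (by positivity) (sq_half_le_sinh hx.le)
  calc _ ≤ _ := this
    _ = _ := by field_simp

theorem inv_sub_inv_sinh_le (hx : 0 < x) : x⁻¹ - (Real.sinh x)⁻¹ ≤ x := by
  have hs : 0 < Real.sinh x := Real.sinh_pos_iff.2 hx
  have h1 := sinh_le_self_mul_cosh hx.le
  have h2 := cosh_sub_one_le hx.le
  rw [inv_sub_inv hx.ne' hs.ne', div_le_iff₀ (by positivity)]
  nlinarith

theorem inv_le_coth (hx : 0 < x) : x⁻¹ ≤ coth x := by
  have hs : 0 < Real.sinh x := Real.sinh_pos_iff.2 hx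
  rw [coth, le_div_iff₀ hs, inv_mul_le_iff₀ hx]
  exact sinh_le_self_mul_cosh hx.le

theorem coth_sub_inv_le_self (hx : 0 < x) : coth x - x⁻¹ ≤ x := by
  have hs : 0 < Real.sinh x := Real.sinh_pos_iff.2 hx
  have h1 : x ≤ Real.sinh x := Real.self_le_sinh_iff.2 hx.le
  have h2 := cosh_sub_one_le hx.le
  rw [coth, ← one_div, div_sub_div _ _ hs.ne' hx.ne', div_le_iff₀ (by positivity)]
  nlinarith

theorem coth_sub_inv_le_one (hx : 0 < x) : coth x - x⁻¹ ≤ 1 := by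
  have hs : 0 < Real.sinh x := Real.sinh_pos_iff.2 hx
  have h1 : x ≤ Real.sinh x := Real.self_le_sinh_iff.2 hx.le
  have h2 : Real.cosh x - Real.sinh x ≤ 1 := by
    rw [Real.cosh_sub_sinh]; exact Real.exp_le_one_iff.2 (by linarith)
  rw [coth, ← one_div, div_sub_div _ _ hs.ne' hx.ne', div_le_iff₀ (by positivity)]
  nlinarith

/-- An integrable-at-infinity weight that is comparable to `min x⁻¹ x⁻²`. -/
def weight (x : ℝ) : ℝ := (x * (1 + x))⁻¹

theorem weight_pos (hx : 0 < x) : 0 < weight x := by unfold weight; positivity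

theorem weight_anti {y : ℝ} (hx : 0 < x) (hxy : x ≤ y) : weight y ≤ weight x := by
  unfold weight
  have hy := hx.trans_le hxy
  exact inv_anti₀ (by positivity) (by gcongr)

theorem inv_le_two_mul_weight (hx : 0 < x) (h1 : x ≤ 1) : x⁻¹ ≤ 2 * weight x := by
  unfold weight
  rw [mul_inv, ← mul_assoc, mul_comm 2, mul_assoc]
  refine le_mul_of_one_le_right (by positivity) ?_
  rw [← div_eq_mul_inv, one_le_div (by positivity)]
  linarith

theorem inv_sq_le_two_mul_weight (h1 : 1 ≤ x) : x⁻¹ ^ 2 ≤ 2 * weight x := by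
  have hx : 0 < x := by linarith
  unfold weight
  rw [mul_inv, ← mul_assoc, mul_comm 2, mul_assoc, sq]
  refine mul_le_mul_of_nonneg_left ?_ (by positivity)
  rw [← div_eq_mul_inv, le_div_iff₀ (by positivity), inv_mul_le_iff₀ hx]
  linarith

theorem inv_sq_eq_mul_weight (hx : 0 < x) : x⁻¹ ^ 2 = (1 + x⁻¹) * weight x := by
  unfold weight
  field_simp
  ring

theorem quadratic_error_le_weight (hx : 0 < x) :
    (Real.sinh x)⁻¹ * ((coth x + x⁻¹) * (coth x - x⁻¹))
      + (x⁻¹ - (Real.sinh x)⁻¹) * x⁻¹ ^ 2 ≤ 14 * weight x := by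
  have hq : 0 < (Real.sinh x)⁻¹ := inv_pos.2 (Real.sinh_pos_iff.2 hx)
  have e1 := inv_sinh_le_inv hx
  have e2 := inv_sinh_le_two_mul_inv_sq hx
  have e3 := inv_sub_inv_sinh_le hx
  have e4 := inv_le_coth hx
  have e5 := coth_sub_inv_le_self hx
  have e6 := coth_sub_inv_le_one hx
  have hp : 0 < x⁻¹ := inv_pos.2 hx
  have hpx : x⁻¹ * x = 1 := inv_mul_cancel₀ hx.ne'
  have hp2 : x⁻¹ ^ 2 * x = x⁻¹ := by rw [sq, mul_assoc, hpx, mul_one]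
  rcases le_total x 1 with h | h
  · have hw := inv_le_two_mul_weight hx h
    have a1 : (coth x + x⁻¹) * (coth x - x⁻¹) ≤ 3 := by
      calc _ ≤ (x + 2 * x⁻¹) * x := by
            apply mul_le_mul (by linarith) e5 (by linarith) (by positivity)
        _ = x * x + 2 * (x⁻¹ * x) := by ring
        _ ≤ 3 := by rw [hpx]; nlinarith
    have a2 := mul_le_mul e1 a1 (mul_nonneg (by linarith) (by linarith)) hp.le
    have a3 : (x⁻¹ - (Real.sinh x)⁻¹) * x⁻¹ ^ 2 ≤ x⁻¹ := by
      nlinarith [mul_le_mul_of_nonneg_right e3 (sq_nonneg x⁻¹)]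
    linarith
  · have hw := inv_sq_le_two_mul_weight h
    have hp1 : x⁻¹ ≤ 1 := inv_le_one_of_one_le₀ h
    have a1 : (coth x + x⁻¹) * (coth x - x⁻¹) ≤ 3 := by
      calc _ ≤ (1 + 2 * x⁻¹) * 1 := by
            apply mul_le_mul (by linarith) e6 (by linarith) (by positivity)
        _ ≤ 3 := by linarith
    have a2 := mul_le_mul e2 a1 (mul_nonneg (by linarith) (by linarith)) (by positivity)
    have a3 : (x⁻¹ - (Real.sinh x)⁻¹) * x⁻¹ ^ 2 ≤ x⁻¹ ^ 2 := by
      nlinarith [sq_nonneg x⁻¹]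
    linarith

theorem abs_deriv_kernel_le_weight (hx : 0 < x) :
    |2 * (x⁻¹ ^ 3 - (Real.sinh x)⁻¹ ^ 3) - (Real.sinh x)⁻¹| ≤ 16 * weight x := by
  have e1 := inv_sinh_le_inv hx
  have e2 := inv_sinh_le_two_mul_inv_sq hx
  have e3 := inv_sub_inv_sinh_le hx
  have hpx : x⁻¹ * x = 1 := inv_mul_cancel₀ hx.ne'
  have hq : 0 < (Real.sinh x)⁻¹ := inv_pos.2 (Real.sinh_pos_iff.2 hx)
  have hp : 0 < x⁻¹ := inv_pos.2 hx
  set p := x⁻¹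
  set q := (Real.sinh x)⁻¹
  have h3 : q ^ 3 ≤ p ^ 3 := by gcongr
  rw [abs_le]
  rcases le_total x 1 with h | h
  · have hw := inv_le_two_mul_weight hx h
    have a1 : p ^ 3 - q ^ 3 ≤ 3 * p := by
      calc p ^ 3 - q ^ 3 = (p - q) * (p * p + p * q + q * q) := by ring
        _ ≤ x * (p * p + p * p + p * p) := by gcongr
        _ = 3 * p * (p * x) := by ring
        _ = 3 * p := by rw [hpx, mul_one]
    constructor <;> linarith
  · have hw := inv_sq_le_two_mul_weight h
    have hp1 : p ≤ 1 := inv_le_one_of_one_le₀ h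
    have a1 : p ^ 3 ≤ p ^ 2 := pow_le_pow_of_le_one hp.le hp1 (by norm_num)
    have a2 : 0 < q ^ 3 := by positivity
    have hw0 := weight_pos hx
    constructor <;> linarith

/-- The primitive of `kernel` on `(0, ∞)`. -/
def kernelPrimitive (x : ℝ) : ℝ := x⁻¹ - (Real.sinh x)⁻¹

/-- The difference of the two summands when `f` is the identity and `a = 1`. -/
def kernel (x : ℝ) : ℝ := (Real.sinh x)⁻¹ * coth x - x⁻¹ * x⁻¹

theorem hasDerivAt_kernelPrimitive (hx : 0 < x) :
    HasDerivAt kernelPrimitive (kernel x) x := by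
  have hs : Real.sinh x ≠ 0 := (Real.sinh_pos_iff.2 hx).ne'
  refine ((hasDerivAt_inv hx.ne').sub ((Real.hasDerivAt_sinh x).inv hs)).congr_deriv ?_
  unfold kernel coth
  field_simp
  ring

theorem hasDerivAt_kernel (hx : 0 < x) :
    HasDerivAt kernel (2 * (x⁻¹ ^ 3 - (Real.sinh x)⁻¹ ^ 3) - (Real.sinh x)⁻¹) x := by
  have hs : Real.sinh x ≠ 0 := (Real.sinh_pos_iff.2 hx).ne'
  have h1 := (Real.hasDerivAt_sinh x).inv hs
  have h2 := hasDerivAt_inv hx.ne'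
  have h3 := (h1.mul ((Real.hasDerivAt_cosh x).div (Real.hasDerivAt_sinh x) hs)).sub (h2.mul h2)
  refine h3.congr_deriv ?_
  have hc := Real.cosh_sq' x
  simp only [Pi.inv_apply, Pi.div_apply]
  field_simp
  rw [hc]
  ring

theorem abs_kernel_sub_le {s y : ℝ} (hx : 0 < x) (hy : y ∈ Set.Icc x (x + s)) :
    |kernel y - kernel x| ≤ 16 * weight x * s := by
  have hxy : x ≤ y := hy.1
  have := (convex_Icc x y).norm_image_sub_le_of_norm_hasDerivWithin_le (f := kernel)
    (fun z hz => (hasDerivAt_kernel (hx.trans_le hz.1)).hasDerivWithinAt)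
    (fun z hz => (abs_deriv_kernel_le_weight (hx.trans_le hz.1)).trans
      (mul_le_mul_of_nonneg_left (weight_anti hx hz.1) (by norm_num)))
    (Set.left_mem_Icc.2 hxy) (Set.right_mem_Icc.2 hxy)
  rw [Real.norm_eq_abs, Real.norm_eq_abs, abs_of_nonneg (sub_nonneg.2 hxy)] at this
  refine this.trans (mul_le_mul_of_nonneg_left (by linarith [hy.2]) ?_)
  have := weight_pos hx
  positivity

theorem abs_kernelPrimitive_sub_le {s : ℝ} (hx : 0 < x) (hs : 0 ≤ s) :
    |kernelPrimitive (x + s) - kernelPrimitive x - s * kernel x| ≤ 16 * s ^ 2 * weight x := by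
  have := (convex_Icc x (x + s)).norm_image_sub_le_of_norm_hasDerivWithin_le
    (f := fun y => kernelPrimitive y - y * kernel x)
    (f' := fun y => kernel y - kernel x) (C := 16 * weight x * s)
    (fun z hz => (((hasDerivAt_kernelPrimitive (hx.trans_le hz.1)).sub
      ((hasDerivAt_id' z).mul_const (kernel x))).congr_deriv (by ring)).hasDerivWithinAt)
    (fun z hz => abs_kernel_sub_le hx hz)
    (Set.left_mem_Icc.2 (by linarith)) (Set.right_mem_Icc.2 (by linarith))
  rw [Real.norm_eq_abs, Real.norm_eq_abs, add_sub_cancel_left, abs_of_nonneg hs] at this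
  calc _ = |kernelPrimitive (x + s) - (x + s) * kernel x
        - (kernelPrimitive x - x * kernel x)| := by congr 1; ring
    _ ≤ _ := this
    _ = _ := by ring

theorem kernelPrimitive_nonneg (hx : 0 < x) : 0 ≤ kernelPrimitive x :=
  sub_nonneg.2 (inv_sinh_le_inv hx)

theorem kernelPrimitive_le_inv (hx : 0 < x) : kernelPrimitive x ≤ x⁻¹ :=
  sub_le_self _ (inv_nonneg.2 (Real.sinh_nonneg_iff.2 hx.le))

theorem mul_weight_add_le {s : ℝ} (hx : 0 < x) (hs : 0 ≤ s) :
    s * weight (x + s) ≤ (Real.log (x + s) - Real.log (1 + (x + s)))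
      - (Real.log x - Real.log (1 + x)) := by
  have hr : 0 < (x + s) * (1 + x) / (x * (1 + (x + s))) := by positivity
  have h := Real.one_sub_inv_le_log_of_pos hr
  rw [Real.log_div (by positivity) (by positivity), Real.log_mul (by positivity) (by positivity),
    Real.log_mul (by positivity) (by positivity)] at h
  have h2 : s * weight (x + s) ≤ 1 - ((x + s) * (1 + x) / (x * (1 + (x + s))))⁻¹ := by
    have : 1 - ((x + s) * (1 + x) / (x * (1 + (x + s))))⁻¹ = s * ((x + s) * (1 + x))⁻¹ := by
      field_simp
      ring
    rw [this, weight]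
    gcongr
    linarith
  linarith

end Pointwise

section Grid

variable {s c : ℝ}

theorem mul_sum_weight_le (hs : 0 < s) (hc : 0 < c) (N : ℕ) :
    s * ∑ m ∈ Finset.range N, weight (m * s + c) ≤ s / c + Real.log (1 + 1 / c) := by
  have key : ∀ n : ℕ, s * ∑ m ∈ Finset.range (n + 1), weight (m * s + c) ≤ s * weight c +
      ((Real.log (n * s + c) - Real.log (1 + (n * s + c))) -
        (Real.log c - Real.log (1 + c))) := by
    intro n
    induction n with
    | zero => simp
    | succ n ih =>
      have h := mul_weight_add_le (x := n * s + c) (by positivity) hs.le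
      have e : ((n + 1 : ℕ) : ℝ) * s + c = n * s + c + s := by push_cast; ring
      rw [Finset.sum_range_succ, mul_add, e]
      linarith
  have hle : ∑ m ∈ Finset.range N, weight (m * s + c) ≤
      ∑ m ∈ Finset.range (N + 1), weight (m * s + c) := by
    rw [Finset.sum_range_succ]
    exact le_add_of_nonneg_right (weight_pos (by positivity)).le
  have h1 : Real.log (N * s + c) ≤ Real.log (1 + (N * s + c)) :=
    Real.log_le_log (by positivity) (by linarith)
  have h2 : Real.log (1 + 1 / c) = Real.log (1 + c) - Real.log c := by
    rw [← Real.log_div (by positivity) hc.ne']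
    congr 1
    field_simp
    ring
  have h3 : s * weight c ≤ s / c := by
    rw [div_eq_mul_inv]
    unfold weight
    gcongr
    nlinarith
  linarith [mul_le_mul_of_nonneg_left hle hs.le, key N]

theorem summable_weight (hs : 0 < s) (hc : 0 < c) :
    Summable fun m : ℕ => weight (m * s + c) := by
  refine summable_of_sum_range_le (c := (s / c + Real.log (1 + 1 / c)) / s)
    (fun m => (weight_pos (by positivity)).le) fun N => ?_
  rw [le_div_iff₀ hs, mul_comm]
  exact mul_sum_weight_le hs hc N

theorem abs_mul_sum_kernel_le (hs : 0 < s) (hc : 0 < c) (N : ℕ) :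
    |s * ∑ m ∈ Finset.range N, kernel (m * s + c)| ≤
      kernelPrimitive (N * s + c) + kernelPrimitive c +
        16 * s * (s / c + Real.log (1 + 1 / c)) := by
  have key : ∀ n : ℕ, |kernelPrimitive (n * s + c) - kernelPrimitive c -
      s * ∑ m ∈ Finset.range n, kernel (m * s + c)| ≤
        16 * s ^ 2 * ∑ m ∈ Finset.range n, weight (m * s + c) := by
    intro n
    induction n with
    | zero => simp
    | succ n ih =>
      have h := abs_kernelPrimitive_sub_le (x := n * s + c) (by positivity) hs.le
      have e : ((n + 1 : ℕ) : ℝ) * s + c = n * s + c + s := by push_cast; ring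
      rw [Finset.sum_range_succ, Finset.sum_range_succ, mul_add, mul_add, e]
      rw [abs_le] at *
      constructor <;> linarith
  have h1 := key N
  have h2 := mul_le_mul_of_nonneg_left (mul_sum_weight_le hs hc N)
    (by positivity : 0 ≤ 16 * s)
  have h3 := kernelPrimitive_nonneg hc
  have h4 := kernelPrimitive_nonneg (x := N * s + c) (by positivity)
  rw [abs_le] at *
  constructor <;> nlinarith

end Grid

theorem abs_pow_add_two_sub_le {R t u : ℝ} (hR : 1 ≤ R) (ht : |t| ≤ R) (hu : |u| ≤ R) (k : ℕ) :
    |t ^ (k + 2) - u ^ (k + 2)| ≤ (2 * R) ^ (k + 2) * ((|t| + |u|) * |t - u|) := by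
  have hR0 : 0 < R := by linarith
  have hM : max |t| |u| ≤ |t| + |u| := max_le (by linarith [abs_nonneg u]) (by linarith [abs_nonneg t])
  have hMR : max |t| |u| ≤ R := max_le ht hu
  have hk : ((k + 2 : ℕ) : ℝ) ≤ 2 ^ (k + 2) := by
    exact_mod_cast (Nat.lt_two_pow_self (n := k + 2)).le
  have hM0 : 0 ≤ max |t| |u| := (abs_nonneg t).trans (le_max_left _ _)
  calc _ ≤ |t - u| * ((k + 2 : ℕ) : ℝ) * max |t| |u| ^ (k + 2 - 1) := abs_pow_sub_pow_le _ _ _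
    _ = |t - u| * ((k + 2 : ℕ) : ℝ) * (max |t| |u| ^ k * max |t| |u|) := by
        rw [← pow_succ]; rfl
    _ ≤ |t - u| * 2 ^ (k + 2) * (R ^ (k + 2) * (|t| + |u|)) := by
        gcongr
        exact (pow_le_pow_left₀ hM0 hMR k).trans (pow_le_pow_right₀ hR (by omega))
    _ = _ := by rw [mul_pow]; ring

theorem exists_second_order_bound {f : ℝ → ℝ} {b : ℕ → ℝ}
    (hbsum : ∀ R > 0, Summable fun k : ℕ => |b k| * R ^ k)
    (hf : ∀ t : ℝ, f t = ∑' k : ℕ, b k * t ^ k) (R : ℝ) :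
    ∃ L ≥ 0, ∀ t u : ℝ, |t| ≤ R → |u| ≤ R →
      |f t - f u - b 1 * (t - u)| ≤ L * ((|t| + |u|) * |t - u|) := by
  wlog hR : 1 ≤ R generalizing R
  · obtain ⟨L, hL, h⟩ := this 1 le_rfl
    exact ⟨L, hL, fun t u ht hu => h t u (by linarith) (by linarith)⟩
  have hsum : ∀ t, HasSum (fun k => b k * t ^ k) (f t) := by
    intro t
    rw [hf t]
    refine Summable.hasSum (Summable.of_norm_bounded (hbsum (|t| + 1) (by positivity)) fun k => ?_)
    rw [Real.norm_eq_abs, abs_mul, abs_pow]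
    gcongr
    linarith
  have hS := hbsum (2 * R) (by linarith)
  refine ⟨∑' k, |b k| * (2 * R) ^ k, tsum_nonneg fun k => by positivity, fun t u ht hu => ?_⟩
  have h1 : HasSum (fun k => b (k + 2) * (t ^ (k + 2) - u ^ (k + 2)))
      (f t - f u - b 1 * (t - u)) := by
    have h := (hasSum_nat_add_iff' 2).2 ((hsum t).sub (hsum u))
    simp only [Finset.sum_range_succ, Finset.sum_range_zero, pow_zero, pow_one] at h
    rw [show f t - f u - b 1 * (t - u) =
      f t - f u - (0 + (b 0 * 1 - b 0 * 1) + (b 1 * t - b 1 * u)) by ring]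
    simpa only [mul_sub] using h
  have h2 : Summable fun k => |b (k + 2)| * (2 * R) ^ (k + 2) := (summable_nat_add_iff 2).2 hS
  have h3 : ∑' k, |b (k + 2)| * (2 * R) ^ (k + 2) ≤ ∑' k, |b k| * (2 * R) ^ k := by
    rw [← hS.sum_add_tsum_nat_add 2]
    exact le_add_of_nonneg_left (Finset.sum_nonneg fun k _ => by positivity)
  rw [← h1.tsum_eq, ← Real.norm_eq_abs]
  refine (tsum_of_norm_bounded (h2.mul_right ((|t| + |u|) * |t - u|)).hasSum fun k => ?_).trans ?_
  · rw [Real.norm_eq_abs, abs_mul, mul_assoc]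
    exact mul_le_mul_of_nonneg_left (abs_pow_add_two_sub_le hR ht hu k) (abs_nonneg _)
  · rw [tsum_mul_right]
    gcongr

section Comparison

variable {f : ℝ → ℝ} {β L R a : ℝ}

theorem abs_summand_sub_le (ha : 0 ≤ a) (hL : 0 ≤ L) (h0 : f 0 = 0)
    (hfR : ∀ t u : ℝ, |t| ≤ R → |u| ≤ R →
      |f t - f u - β * (t - u)| ≤ L * ((|t| + |u|) * |t - u|))
    {x : ℝ} (hx : 0 < x) (hxR : a * coth x ≤ R) :
    |4 * Real.pi * a / Real.sinh x * f (a * coth x) - 4 * Real.pi * a / x * f (a / x)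
      - 4 * Real.pi * a ^ 2 * β * kernel x| ≤ 56 * Real.pi * L * a ^ 3 * weight x := by
  have e1 := inv_sinh_le_inv hx
  have hq : 0 < (Real.sinh x)⁻¹ := inv_pos.2 (Real.sinh_pos_iff.2 hx)
  have hp : 0 < x⁻¹ := inv_pos.2 hx
  have hk := inv_le_coth hx
  have hB0 : 0 ≤ a * x⁻¹ := by positivity
  have hBA : a * x⁻¹ ≤ a * coth x := mul_le_mul_of_nonneg_left hk ha
  have hA0 := hB0.trans hBA
  have hAR : |a * coth x| ≤ R := by rwa [abs_of_nonneg hA0]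
  have hBR : |a * x⁻¹| ≤ R := by rw [abs_of_nonneg hB0]; exact hBA.trans hxR
  have g1 := hfR _ _ hAR hBR
  have g2 := hfR _ 0 hBR (by rw [abs_zero]; exact (abs_nonneg _).trans hBR)
  rw [h0, sub_zero, sub_zero, abs_zero, add_zero, abs_of_nonneg hB0] at g2
  rw [abs_of_nonneg hA0, abs_of_nonneg hB0, abs_of_nonneg (sub_nonneg.2 hBA)] at g1
  have hpi := Real.pi_pos
  have hsplit : 4 * Real.pi * a / Real.sinh x * f (a * coth x) - 4 * Real.pi * a / x * f (a / x)
      - 4 * Real.pi * a ^ 2 * β * kernel x = 4 * Real.pi * a *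
        ((Real.sinh x)⁻¹ * (f (a * coth x) - f (a * x⁻¹) - β * (a * coth x - a * x⁻¹))
          - (x⁻¹ - (Real.sinh x)⁻¹) * (f (a * x⁻¹) - β * (a * x⁻¹))) := by
    simp only [kernel, div_eq_mul_inv]
    ring
  rw [hsplit, abs_mul, abs_of_nonneg (by positivity : 0 ≤ 4 * Real.pi * a)]
  have hpq : 0 ≤ x⁻¹ - (Real.sinh x)⁻¹ := sub_nonneg.2 e1
  calc _ ≤ 4 * Real.pi * a * (
        (Real.sinh x)⁻¹ * (L * ((a * coth x + a * x⁻¹) * (a * coth x - a * x⁻¹)))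
          + (x⁻¹ - (Real.sinh x)⁻¹) * (L * (a * x⁻¹ * (a * x⁻¹)))) := by
        refine mul_le_mul_of_nonneg_left ((abs_sub _ _).trans ?_) (by positivity)
        rw [abs_mul, abs_mul, abs_of_pos hq, abs_of_nonneg hpq]
        gcongr
    _ = 4 * Real.pi * L * a ^ 3 * ((Real.sinh x)⁻¹ * ((coth x + x⁻¹) * (coth x - x⁻¹))
          + (x⁻¹ - (Real.sinh x)⁻¹) * x⁻¹ ^ 2) := by ring
    _ ≤ 4 * Real.pi * L * a ^ 3 * (14 * weight x) :=
        mul_le_mul_of_nonneg_left (quadratic_error_le_weight hx) (by positivity)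
    _ = _ := by ring

theorem abs_tsum_sub_tsum_le (ha : 0 < a) (hL : 0 ≤ L) (h0 : f 0 = 0)
    (hfR : ∀ t u : ℝ, |t| ≤ R → |u| ≤ R →
      |f t - f u - β * (t - u)| ≤ L * ((|t| + |u|) * |t - u|))
    {s c : ℝ} (hc : 0 < c) (hcs : c ≤ s) (hR : a + a / c ≤ R) :
    |(∑' m : ℕ, (4 * Real.pi * a / Real.sinh (m * s + c)) * f (a * coth (m * s + c))) -
        ∑' m : ℕ, (4 * Real.pi * a / (m * s + c)) * f (a / (m * s + c))| ≤
      4 * Real.pi * a ^ 2 * (|β| * (2 + 16 * (s / c + Real.log (1 + 1 / c))) +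
        14 * L * (a / s) * (s / c + Real.log (1 + 1 / c))) := by
  have hs : 0 < s := hc.trans_le hcs
  have hX : ∀ m : ℕ, 0 < m * s + c := fun m => by positivity
  have hcX : ∀ m : ℕ, c ≤ m * s + c := fun m => le_add_of_nonneg_left (by positivity)
  have hinv : ∀ m : ℕ, (m * s + c)⁻¹ ≤ c⁻¹ := fun m => inv_anti₀ hc (hcX m)
  have hAR : ∀ m : ℕ, a * coth (m * s + c) ≤ R := fun m => by
    have h1 := coth_sub_inv_le_one (hX m)
    have h2 := hinv m
    calc _ ≤ a * (1 + c⁻¹) := by gcongr; linarith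
      _ = a + a / c := by ring
      _ ≤ R := hR
  have hR0 : 0 ≤ R := by linarith [div_pos ha hc]
  have hA0 : ∀ m : ℕ, 0 ≤ a * coth (m * s + c) := fun m =>
    mul_nonneg ha.le ((inv_nonneg.2 (hX m).le).trans (inv_le_coth (hX m)))
  have hBR : ∀ m : ℕ, a / (m * s + c) ≤ R := fun m => by
    refine le_trans ?_ (hAR m)
    rw [div_eq_mul_inv]
    exact mul_le_mul_of_nonneg_left (inv_le_coth (hX m)) ha.le
  have hfb : ∀ t, 0 ≤ t → t ≤ R → |f t| ≤ (L * R + |β|) * t := by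
    intro t ht htR
    have h := hfR t 0 (by rwa [abs_of_nonneg ht]) (by rwa [abs_zero])
    rw [h0, sub_zero, sub_zero, abs_zero, add_zero, abs_of_nonneg ht] at h
    have h2 : |f t| ≤ |f t - β * t| + |β * t| := by
      simpa using abs_add_le (f t - β * t) (β * t)
    rw [abs_mul, abs_of_nonneg ht] at h2
    nlinarith [mul_le_mul_of_nonneg_left (mul_le_mul_of_nonneg_right htR ht) hL]
  have hK : 0 ≤ L * R + |β| := by positivity
  have hw := summable_weight hs hc
  have hinv2 : ∀ m : ℕ, (m * s + c)⁻¹ ^ 2 ≤ (1 + c⁻¹) * weight (m * s + c) := fun m => by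
    rw [inv_sq_eq_mul_weight (hX m)]
    exact mul_le_mul_of_nonneg_right (by linarith [hinv m]) (weight_pos (hX m)).le
  have hpi := Real.pi_pos
  have S1 : Summable fun m : ℕ =>
      (4 * Real.pi * a / Real.sinh (m * s + c)) * f (a * coth (m * s + c)) := by
    refine Summable.of_norm_bounded
      (hw.mul_left (4 * Real.pi * a * 2 * (1 + c⁻¹) * ((L * R + |β|) * R))) fun m => ?_
    have hq : 0 < (Real.sinh (m * s + c))⁻¹ := inv_pos.2 (Real.sinh_pos_iff.2 (hX m))
    rw [Real.norm_eq_abs, abs_mul, div_eq_mul_inv, abs_of_nonneg (by positivity)]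
    have h1 := inv_sinh_le_two_mul_inv_sq (hX m)
    calc _ ≤ 4 * Real.pi * a * (2 * ((1 + c⁻¹) * weight (m * s + c))) * ((L * R + |β|) * R) := by
          refine mul_le_mul (mul_le_mul_of_nonneg_left ?_ (by positivity)) ?_ (abs_nonneg _) ?_
          · linarith [hinv2 m]
          · exact (hfb _ (hA0 m) (hAR m)).trans (mul_le_mul_of_nonneg_left (hAR m) hK)
          · have := weight_pos (hX m)
            positivity
      _ = _ := by ring
  have S2 : Summable fun m : ℕ =>
      (4 * Real.pi * a / (m * s + c)) * f (a / (m * s + c)) := by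
    refine Summable.of_norm_bounded
      (hw.mul_left (4 * Real.pi * a ^ 2 * (1 + c⁻¹) * (L * R + |β|))) fun m => ?_
    have hx := hX m
    rw [Real.norm_eq_abs, abs_mul, abs_of_nonneg (by positivity)]
    calc _ ≤ 4 * Real.pi * a / (m * s + c) * ((L * R + |β|) * (a / (m * s + c))) := by
          gcongr
          exact hfb _ (by positivity) (hBR m)
      _ = 4 * Real.pi * a ^ 2 * (L * R + |β|) * (m * s + c)⁻¹ ^ 2 := by ring
      _ ≤ 4 * Real.pi * a ^ 2 * (L * R + |β|) * ((1 + c⁻¹) * weight (m * s + c)) :=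
          mul_le_mul_of_nonneg_left (hinv2 m) (by positivity)
      _ = _ := by ring
  rw [← S1.tsum_sub S2]
  refine le_of_tendsto ((S1.sub S2).hasSum.tendsto_sum_nat.abs) ?_
  filter_upwards [Filter.eventually_ge_atTop ⌈(s⁻¹) / s⌉₊] with N hN
  set U := s / c + Real.log (1 + 1 / c)
  have hNs : s⁻¹ ≤ N * s + c := by
    have := (div_le_iff₀ hs).1 (Nat.ceil_le.1 hN)
    linarith
  have hPN : kernelPrimitive (N * s + c) ≤ s :=
    (kernelPrimitive_le_inv (hX N)).trans (inv_le_of_inv_le₀ hs hNs)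
  have hPc : kernelPrimitive c ≤ s := (inv_sub_inv_sinh_le hc).trans hcs
  have hker : |∑ m ∈ Finset.range N, kernel (m * s + c)| ≤ 2 + 16 * U := by
    have h := abs_mul_sum_kernel_le hs hc N
    rw [abs_mul, abs_of_pos hs] at h
    refine le_of_mul_le_mul_left (h.trans ?_) hs
    change _ + _ + 16 * s * U ≤ _
    linarith
  have hwt : ∑ m ∈ Finset.range N, weight (m * s + c) ≤ U / s := by
    rw [le_div_iff₀ hs, mul_comm]
    exact mul_sum_weight_le hs hc N
  have herr := (Finset.abs_sum_le_sum_abs _ (Finset.range N)).trans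
    (Finset.sum_le_sum fun m (_ : m ∈ Finset.range N) =>
      abs_summand_sub_le ha.le hL h0 hfR (hX m) (hAR m))
  rw [Finset.sum_sub_distrib, ← Finset.mul_sum, ← Finset.mul_sum] at herr
  have hmain : |4 * Real.pi * a ^ 2 * β * ∑ m ∈ Finset.range N, kernel (m * s + c)| ≤
      4 * Real.pi * a ^ 2 * |β| * (2 + 16 * U) := by
    rw [abs_mul, abs_mul, abs_of_nonneg (by positivity : 0 ≤ 4 * Real.pi * a ^ 2)]
    gcongr
  have herr2 : 56 * Real.pi * L * a ^ 3 * ∑ m ∈ Finset.range N, weight (m * s + c) ≤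
      56 * Real.pi * L * a ^ 3 * (U / s) := by gcongr
  calc _ ≤ 4 * Real.pi * a ^ 2 * |β| * (2 + 16 * U) + 56 * Real.pi * L * a ^ 3 * (U / s) := by
        rw [← sub_add_cancel (∑ m ∈ Finset.range N, _)
          (4 * Real.pi * a ^ 2 * β * ∑ m ∈ Finset.range N, kernel (m * s + c))]
        exact (abs_add_le _ _).trans (by linarith)
    _ = _ := by ring

end Comparison

theorem arsinh_le_self_s6 {y : ℝ} (hy : 0 ≤ y) : Real.arsinh y ≤ y := by
  have := Real.self_le_sinh_iff.2 (Real.arsinh_nonneg_iff.2 hy)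
  rwa [Real.sinh_arsinh] at this

theorem half_le_arsinh {y : ℝ} (hy : 0 ≤ y) (hy1 : y ≤ 1) : y / 2 ≤ Real.arsinh y := by
  have hz : 0 ≤ y / 2 := by linarith
  have h0 : 0 ≤ Real.sinh (y / 2) := Real.sinh_nonneg_iff.2 hz
  have h1 := sinh_le_self_mul_cosh hz
  have h2 := cosh_sub_one_le hz
  rw [← Real.sinh_le_sinh, Real.sinh_arsinh]
  have h3 : (y / 2) ^ 2 * Real.sinh (y / 2) ≤ 1 / 4 * Real.sinh (y / 2) :=
    mul_le_mul_of_nonneg_right (by nlinarith) h0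
  nlinarith [mul_le_mul_of_nonneg_left h2 hz]

theorem aEps_sq_bounds {r₁ r₂ ε : ℝ} (hr₁ : 0 < r₁) (hr₂ : 0 < r₂) (hε : 0 < ε) (hε1 : ε ≤ 1) :
    2 * r₁ * (2 * r₂) * (2 * r₁ + 2 * r₂) / (2 * (r₁ + r₂ + 1)) ^ 2 * ε ≤ aEps r₁ r₂ ε ^ 2 ∧
    aEps r₁ r₂ ε ^ 2 ≤
      (2 * r₁ + 1) * (2 * r₂ + 1) * (2 * r₁ + 2 * r₂ + 1) / (2 * (r₁ + r₂)) ^ 2 * ε := by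
  have h : aEps r₁ r₂ ε ^ 2 =
      (2 * r₁ + ε) * (2 * r₂ + ε) * (2 * r₁ + 2 * r₂ + ε) / (2 * (r₁ + r₂ + ε)) ^ 2 * ε := by
    rw [aEps, div_pow, mul_pow, Real.sq_sqrt hε.le, Real.sq_sqrt (by positivity)]
    ring
  rw [h]
  constructor
  · refine mul_le_mul_of_nonneg_right (div_le_div₀ (by positivity) ?_ (by positivity) ?_) hε.le
    · refine mul_le_mul (mul_le_mul ?_ ?_ ?_ ?_) ?_ ?_ ?_ <;> first | linarith | positivity
    · gcongr
  · refine mul_le_mul_of_nonneg_right (div_le_div₀ (by positivity) ?_ (by positivity) ?_) hε.le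
    · gcongr
    · exact pow_le_pow_left₀ (by positivity) (by linarith) 2

theorem aEps_pos {r₁ r₂ ε : ℝ} (hr₁ : 0 < r₁) (hr₂ : 0 < r₂) (hε : 0 < ε) :
    0 < aEps r₁ r₂ ε := by
  unfold aEps
  positivity

theorem stmt6 (r₁ r₂ : ℝ) (hr₁ : 0 < r₁) (hr₂ : 0 < r₂)
    (f : ℝ → ℝ) (b : ℕ → ℝ) (hb0 : b 0 = 0)
    (hbsum : ∀ R > 0, Summable fun k : ℕ => |b k| * R ^ k)
    (hf : ∀ t : ℝ, f t = ∑' k : ℕ, b k * t ^ k) :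
    ∃ C > 0, ∃ ε₀ > 0, ∀ ε ∈ Set.Ioo 0 ε₀,
      ∀ c ∈ ({xi r₁ r₁ r₂ ε, xi r₂ r₁ r₂ ε, xi r₁ r₁ r₂ ε + xi r₂ r₁ r₂ ε} : Set ℝ),
        |(∑' m : ℕ, (4 * Real.pi * aEps r₁ r₂ ε /
              Real.sinh (m * (xi r₁ r₁ r₂ ε + xi r₂ r₁ r₂ ε) + c)) *
            f (aEps r₁ r₂ ε * coth (m * (xi r₁ r₁ r₂ ε + xi r₂ r₁ r₂ ε) + c))) -
          ∑' m : ℕ, (4 * Real.pi * aEps r₁ r₂ ε /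
              (m * (xi r₁ r₁ r₂ ε + xi r₂ r₁ r₂ ε) + c)) *
            f (aEps r₁ r₂ ε / (m * (xi r₁ r₁ r₂ ε + xi r₂ r₁ r₂ ε) + c))| ≤
        C * ε * |Real.log ε| := by
  have hf0 : f 0 = 0 := by
    rw [hf 0]
    refine (tsum_congr fun k => ?_).trans tsum_zero
    rcases k with _ | k
    · simp [hb0]
    · simp
  set p := 2 * r₁ * (2 * r₂) * (2 * r₁ + 2 * r₂) / (2 * (r₁ + r₂ + 1)) ^ 2 with hp
  set P := (2 * r₁ + 1) * (2 * r₂ + 1) * (2 * r₁ + 2 * r₂ + 1) / (2 * (r₁ + r₂)) ^ 2 with hP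
  have hp0 : 0 < p := by positivity
  have hP0 : 0 < P := by positivity
  obtain ⟨κ, hκ0, hκ₁, hκ₂⟩ : ∃ κ : ℝ, 0 < κ ∧ κ ≤ 1 / (2 * r₁) ∧ κ ≤ 1 / (2 * r₂) :=
    ⟨min (1 / (2 * r₁)) (1 / (2 * r₂)), by positivity, min_le_left _ _, min_le_right _ _⟩
  set K := 1 / r₁ + 1 / r₂ with hK
  obtain ⟨δ, hδ0, hδ1, hδr₁, hδr₂, hδp⟩ :
      ∃ δ : ℝ, 0 < δ ∧ δ ≤ 1 ∧ δ ≤ r₁ ∧ δ ≤ r₂ ∧ δ ≤ p / (1 + 1 / κ) :=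
    ⟨min (min 1 r₁) (min r₂ (p / (1 + 1 / κ))), by positivity,
      (min_le_left _ _).trans (min_le_left _ _), (min_le_left _ _).trans (min_le_right _ _),
      (min_le_right _ _).trans (min_le_left _ _), (min_le_right _ _).trans (min_le_right _ _)⟩
  obtain ⟨L, hL, hfR⟩ := exists_second_order_bound hbsum hf (1 + 1 / κ)
  set M := K / κ + 1 with hM
  have hM0 : 0 < M := by positivity
  have hpi := Real.pi_pos
  refine ⟨4 * Real.pi * P * (|b 1| * (2 + 16 * M) + 14 * L * (1 / κ) * M) + 1, by positivity,
    min (Real.exp (-1)) (δ ^ 2 / P), by positivity, fun ε hε c hc => ?_⟩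
  obtain ⟨hε0, hεlt⟩ := hε
  have hεe : ε < Real.exp (-1) := hεlt.trans_le (min_le_left _ _)
  have hε1 : ε ≤ 1 := hεe.le.trans (Real.exp_le_one_iff.2 (by norm_num))
  have hlog : Real.log ε ≤ -1 := by
    rw [Real.log_le_iff_le_exp hε0]
    exact hεe.le
  have hℓ : |Real.log ε| = -Real.log ε := abs_of_nonpos (by linarith)
  have hℓ1 : 1 ≤ |Real.log ε| := by rw [hℓ]; linarith
  obtain ⟨hlo, hhi⟩ := aEps_sq_bounds hr₁ hr₂ hε0 hε1
  rw [← hp] at hlo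
  rw [← hP] at hhi
  have ha := aEps_pos hr₁ hr₂ hε0
  have haδ : aEps r₁ r₂ ε ≤ δ := by
    refine le_of_sq_le_sq ?_ hδ0.le
    have := (lt_div_iff₀ hP0).1 (hεlt.trans_le (min_le_right _ _))
    linarith
  have hξ : ∀ r : ℝ, 0 < r → δ ≤ r → κ ≤ 1 / (2 * r) →
      κ * aEps r₁ r₂ ε ≤ xi r r₁ r₂ ε ∧ xi r r₁ r₂ ε ≤ 1 / r * aEps r₁ r₂ ε := by
    intro r hr hδr hκr
    have h0 : 0 ≤ aEps r₁ r₂ ε / r := by positivity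
    have h1 : aEps r₁ r₂ ε / r ≤ 1 := (div_le_one hr).2 (haδ.trans hδr)
    constructor
    · refine le_trans ?_ (half_le_arsinh h0 h1)
      calc _ ≤ 1 / (2 * r) * aEps r₁ r₂ ε := by gcongr
        _ = _ := by field_simp
    · refine (arsinh_le_self_s6 h0).trans_eq ?_
      ring
  obtain ⟨l1, u1⟩ := hξ r₁ hr₁ hδr₁ hκ₁
  obtain ⟨l2, u2⟩ := hξ r₂ hr₂ hδr₂ hκ₂
  set a := aEps r₁ r₂ ε
  set s := xi r₁ r₁ r₂ ε + xi r₂ r₁ r₂ ε with hs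
  have hκa : 0 < κ * a := by positivity
  have hsK : s ≤ K * a := by rw [hK, add_mul]; linarith
  have hcb : κ * a ≤ c ∧ c ≤ s := by
    simp only [Set.mem_insert_iff, Set.mem_singleton_iff] at hc
    rcases hc with rfl | rfl | rfl <;> constructor <;> linarith
  obtain ⟨hcl, hcs⟩ := hcb
  have hc0 : 0 < c := hκa.trans_le hcl
  have hac : ∀ y, κ * a ≤ y → a / y ≤ 1 / κ := fun y hy => by
    rw [div_le_div_iff₀ (hκa.trans_le hy) hκ0]
    linarith
  have hsc : s / c ≤ K / κ := by
    rw [div_le_div_iff₀ hc0 hκ0]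
    calc s * κ ≤ K * a * κ := by gcongr
      _ = K * (κ * a) := by ring
      _ ≤ K * c := by gcongr
  have hlogc : Real.log (1 + 1 / c) ≤ |Real.log ε| := by
    rw [hℓ, ← Real.log_inv]
    refine Real.log_le_log (by positivity) ?_
    rw [le_inv_comm₀ (by positivity) hε0, ← one_div, le_div_iff₀ (by positivity)]
    have h1 : a * (1 + 1 / κ) ≤ p := (le_div_iff₀ (by positivity)).1 (haδ.trans hδp)
    have h2 : a ^ 2 * (1 + 1 / c) ≤ a * (1 + 1 / κ) := by
      calc a ^ 2 * (1 + 1 / c) = a * (a + a / c) := by ring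
        _ ≤ a * (1 + 1 / κ) := by
          exact mul_le_mul_of_nonneg_left (add_le_add (haδ.trans hδ1) (hac c hcl)) ha.le
    refine le_of_mul_le_mul_left ?_ hp0
    calc p * (ε * (1 + 1 / c)) = p * ε * (1 + 1 / c) := by ring
      _ ≤ a ^ 2 * (1 + 1 / c) := by gcongr
      _ ≤ p * 1 := by linarith
  have hU : s / c + Real.log (1 + 1 / c) ≤ M * |Real.log ε| := by
    have : K / κ ≤ K / κ * |Real.log ε| := le_mul_of_one_le_right (by positivity) hℓ1
    rw [hM, add_mul]
    linarith
  have hU0 : 0 ≤ s / c + Real.log (1 + 1 / c) :=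
    add_nonneg (div_nonneg (hc0.le.trans hcs) hc0.le)
      (Real.log_nonneg (le_add_of_nonneg_right (by positivity)))
  have hR : a + a / c ≤ 1 + 1 / κ := add_le_add (haδ.trans hδ1) (hac c hcl)
  refine (abs_tsum_sub_tsum_le ha hL hf0 hfR hc0 hcs hR).trans ?_
  have has : a / s ≤ 1 / κ := hac s (hcl.trans hcs)
  have has0 : 0 ≤ a / s := div_nonneg ha.le (hc0.le.trans hcs)
  generalize a / s = q at has has0 ⊢
  generalize s / c + Real.log (1 + 1 / c) = U at hU hU0 ⊢
  calc _ ≤ 4 * Real.pi * (P * ε) * (|b 1| * (2 * |Real.log ε| + 16 * (M * |Real.log ε|)) +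
        14 * L * (1 / κ) * (M * |Real.log ε|)) := by
        gcongr
        linarith
    _ = 4 * Real.pi * P * (|b 1| * (2 + 16 * M) + 14 * L * (1 / κ) * M) * ε * |Real.log ε| := by
        ring
    _ ≤ _ := by
        gcongr
        linarith

end
end
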